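/- (α-theorem) Let f = (f₁,…,f_n) ∈ A²(ω,R)^n and x₀ ∈ B(ω,R) with Df(x₀) invertible; write α = α(f,x₀), γ = γ(f,x₀), κ = κ_{x₀}. Suppose α < 2γ + 1 − √((2γ + 1)² − 1). Then for every θ > 0 such that B(x₀,θ) ⊆ B(ω,R) and (α + 1 − √((α + 1)² − 4α(γ + 1)))/(2(γ + 1)) < κθ < 1/(γ + 1), the system f has a unique zero in the ball B(x₀,θ). -/

import Mathlib

open MeasureTheory Metric

noncomputable section

/-- `ℂⁿ` with the Euclidean (Hermitian) norm. -/
abbrev En (n : ℕ) := EuclideanSpace ℂ (Fin n)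

instance (n : ℕ) : InnerProductSpace ℝ (En n) := InnerProductSpace.rclikeToReal ℂ _
instance (n : ℕ) : MeasurableSpace (En n) := borel _
instance (n : ℕ) : BorelSpace (En n) := ⟨rfl⟩

/-- The `A²(ω,R)` norm: `‖f‖² = (n!/(πⁿ R^{2n})) ∫_{B(ω,R)} ‖f(z)‖² dz`.  For a system
`f = (f₁,…,f_s) : ℂⁿ → ℂˢ` (with `ℂˢ` carrying the Euclidean norm) this is exactly
`(Σᵢ ‖fᵢ‖²)^{1/2}`. -/
def A2Norm {𝓕 : Type*} [NormedAddCommGroup 𝓕] {n : ℕ} (ω : En n) (R : ℝ)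
    (f : En n → 𝓕) : ℝ :=
  Real.sqrt (((n.factorial : ℝ) / (Real.pi ^ n * R ^ (2 * n))) * ∫ z in ball ω R, ‖f z‖ ^ 2)

/-- Membership in `A²(ω,R)`: analytic on the open ball `B(ω,R)` and square integrable there. -/
def MemA2 {𝓕 : Type*} [NormedAddCommGroup 𝓕] [NormedSpace ℂ 𝓕] {n : ℕ}
    (ω : En n) (R : ℝ) (f : En n → 𝓕) : Prop :=
  AnalyticOnNhd ℂ f (ball ω R) ∧ IntegrableOn (fun z => ‖f z‖ ^ 2) (ball ω R)

open scoped InnerProductSpace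

section BallAutomorphism

variable {E : Type*} [NormedAddCommGroup E]

/-- The conformal factor `√(1 - ‖a‖²)` of the unit ball at the point `a`. -/
def ballScale (a : E) : ℝ := Real.sqrt (1 - ‖a‖ ^ 2)

theorem ballScale_nonneg (a : E) : 0 ≤ ballScale a := Real.sqrt_nonneg _

theorem ballScale_le_one (a : E) : ballScale a ≤ 1 :=
  Real.sqrt_le_one.2 (by nlinarith [sq_nonneg ‖a‖])

theorem ballScale_pos {a : E} (ha : ‖a‖ < 1) : 0 < ballScale a := by
  apply Real.sqrt_pos.2
  nlinarith [norm_nonneg a]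

theorem sq_ballScale {a : E} (ha : ‖a‖ < 1) : ballScale a ^ 2 = 1 - ‖a‖ ^ 2 := by
  apply Real.sq_sqrt
  nlinarith [norm_nonneg a]

theorem one_add_ballScale_ne_zero (a : E) : (1 + ballScale a : ℂ) ≠ 0 := by
  have := ballScale_nonneg a
  norm_cast
  positivity

variable [InnerProductSpace ℂ E]

/-- Multiplication by `1 - ‖a‖²` along `a` and by `√(1 - ‖a‖²)` on the orthogonal of `a`. -/
def ballShrink (a : E) : E →L[ℂ] E :=
  (ballScale a : ℂ) • ContinuousLinearMap.id ℂ E -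
    ((ballScale a / (1 + ballScale a) : ℝ) : ℂ) • (innerSL ℂ a).smulRight a

/-- The identity along `a` and multiplication by `√(1 - ‖a‖²)` on the orthogonal of `a`. -/
def ballStretch (a : E) : E →L[ℂ] E :=
  (ballScale a : ℂ) • ContinuousLinearMap.id ℂ E +
    ((1 / (1 + ballScale a) : ℝ) : ℂ) • (innerSL ℂ a).smulRight a

/-- The automorphism of the unit ball sending `0` to `a`. -/
def ballMap (a w : E) : E := a + (1 + ⟪a, w⟫_ℂ)⁻¹ • ballShrink a w

/-- The inverse of `ballMap a`. -/
def ballInv (a z : E) : E := (1 - ⟪a, z⟫_ℂ)⁻¹ • ballStretch a (z - a)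

theorem ballShrink_apply (a w : E) : ballShrink a w =
    (ballScale a : ℂ) • w - ((ballScale a / (1 + ballScale a) : ℝ) : ℂ) • ⟪a, w⟫_ℂ • a := by
  simp [ballShrink]

theorem ballStretch_apply (a w : E) : ballStretch a w =
    (ballScale a : ℂ) • w + ((1 / (1 + ballScale a) : ℝ) : ℂ) • ⟪a, w⟫_ℂ • a := by
  simp [ballStretch]

variable {a : E}

theorem inner_self_eq_ofReal_norm_sq (a : E) : ⟪a, a⟫_ℂ = (‖a‖ : ℂ) ^ 2 :=
  inner_self_eq_norm_sq_to_K a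

theorem inner_self_eq_one_sub_sq_ballScale (ha : ‖a‖ < 1) :
    ⟪a, a⟫_ℂ = 1 - (ballScale a : ℂ) ^ 2 := by
  rw [← Complex.ofReal_pow, sq_ballScale ha, inner_self_eq_ofReal_norm_sq]
  push_cast
  ring

theorem inner_ballShrink (ha : ‖a‖ < 1) (w : E) :
    ⟪a, ballShrink a w⟫_ℂ = (ballScale a : ℂ) ^ 2 * ⟪a, w⟫_ℂ := by
  rw [ballShrink_apply, inner_sub_right, inner_smul_right, inner_smul_right, inner_smul_right,
    inner_self_eq_one_sub_sq_ballScale ha]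
  have := one_add_ballScale_ne_zero a
  push_cast
  field_simp
  ring

theorem inner_ballStretch (ha : ‖a‖ < 1) (w : E) :
    ⟪a, ballStretch a w⟫_ℂ = ⟪a, w⟫_ℂ := by
  rw [ballStretch_apply, inner_add_right, inner_smul_right, inner_smul_right, inner_smul_right,
    inner_self_eq_one_sub_sq_ballScale ha]
  have := one_add_ballScale_ne_zero a
  push_cast
  field_simp
  ring

theorem ballShrink_ballStretch (ha : ‖a‖ < 1) (v : E) :
    ballShrink a (ballStretch a v) = ((ballScale a : ℂ) ^ 2) • v := by
  rw [ballShrink_apply, inner_ballStretch ha, ballStretch_apply]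
  have := one_add_ballScale_ne_zero a
  push_cast
  match_scalars
  · ring
  · field_simp
    ring

theorem ballStretch_ballShrink (ha : ‖a‖ < 1) (v : E) :
    ballStretch a (ballShrink a v) = ((ballScale a : ℂ) ^ 2) • v := by
  rw [ballStretch_apply, inner_ballShrink ha, ballShrink_apply]
  have := one_add_ballScale_ne_zero a
  push_cast
  match_scalars
  · ring
  · field_simp
    ring

theorem inner_ballShrink_ballShrink (ha : ‖a‖ < 1) (v w : E) :
    ⟪ballShrink a v, ballShrink a w⟫_ℂ =
      (ballScale a : ℂ) ^ 2 * (⟪v, w⟫_ℂ - ⟪v, a⟫_ℂ * ⟪a, w⟫_ℂ) := by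
  conv_lhs => rw [ballShrink_apply a v]
  rw [inner_sub_left, inner_smul_left, inner_smul_left, inner_smul_left, inner_ballShrink ha,
    ballShrink_apply, inner_sub_right, inner_smul_right, inner_smul_right, inner_smul_right,
    inner_conj_symm, Complex.conj_ofReal, Complex.conj_ofReal]
  have := one_add_ballScale_ne_zero a
  push_cast
  field_simp
  ring

theorem norm_sq_ballShrink (ha : ‖a‖ < 1) (w : E) :
    ‖ballShrink a w‖ ^ 2 = ballScale a ^ 2 * (‖w‖ ^ 2 - ‖⟪a, w⟫_ℂ‖ ^ 2) := by
  have h := inner_ballShrink_ballShrink ha w w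
  rw [inner_self_eq_ofReal_norm_sq, inner_self_eq_ofReal_norm_sq, ← inner_conj_symm w a,
    ← Complex.normSq_eq_conj_mul_self, Complex.normSq_eq_norm_sq] at h
  exact_mod_cast h

theorem norm_ballShrink_le (ha : ‖a‖ < 1) (w : E) : ‖ballShrink a w‖ ≤ ‖w‖ := by
  have h := norm_sq_ballShrink ha w
  have h1 := ballScale_nonneg a
  have h2 := ballScale_le_one a
  refine le_of_sq_le_sq ?_ (norm_nonneg w)
  have : ballScale a ^ 2 ≤ 1 := by nlinarith
  nlinarith [sq_nonneg (ballScale a * ‖⟪a, w⟫_ℂ‖), sq_nonneg ‖w‖]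

theorem norm_sq_ballStretch (ha : ‖a‖ < 1) (v : E) :
    ‖ballStretch a v‖ ^ 2 = ballScale a ^ 2 * ‖v‖ ^ 2 + ‖⟪a, v⟫_ℂ‖ ^ 2 := by
  have h := norm_sq_ballShrink ha (ballStretch a v)
  have hs := ballScale_pos ha
  rw [ballShrink_ballStretch ha, inner_ballStretch ha, norm_smul, norm_pow, Complex.norm_real,
    Real.norm_of_nonneg hs.le] at h
  have h3 : ballScale a ^ 2 * (‖ballStretch a v‖ ^ 2) =
      ballScale a ^ 2 * (ballScale a ^ 2 * ‖v‖ ^ 2 + ‖⟪a, v⟫_ℂ‖ ^ 2) := by linarith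
  exact mul_left_cancel₀ (by positivity) h3

theorem norm_inner_le_mul (a v : E) : ‖⟪a, v⟫_ℂ‖ ^ 2 ≤ ‖a‖ ^ 2 * ‖v‖ ^ 2 := by
  rw [← mul_pow]
  exact pow_le_pow_left₀ (norm_nonneg _) (norm_inner_le_norm a v) 2

theorem norm_ballStretch_le (ha : ‖a‖ < 1) (v : E) : ‖ballStretch a v‖ ≤ ‖v‖ := by
  have h := norm_sq_ballStretch ha v
  have h1 := norm_inner_le_mul a v
  rw [sq_ballScale ha] at h
  exact le_of_sq_le_sq (by linarith) (norm_nonneg v)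

theorem norm_inner_lt_one {x y : E} (hx : ‖x‖ < 1) (hy : ‖y‖ < 1) : ‖⟪x, y⟫_ℂ‖ < 1 := by
  nlinarith [norm_inner_le_norm (𝕜 := ℂ) x y, norm_nonneg x, norm_nonneg y]

theorem one_add_ne_zero_of_norm_lt_one {q : ℂ} (hq : ‖q‖ < 1) : 1 + q ≠ 0 := by
  intro h
  rw [← neg_eq_iff_add_eq_zero] at h
  rw [← h] at hq
  simp at hq

theorem one_sub_ne_zero_of_norm_lt_one {q : ℂ} (hq : ‖q‖ < 1) : 1 - q ≠ 0 := by
  intro h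
  rw [sub_eq_zero] at h
  rw [← h] at hq
  simp at hq

theorem one_add_inner_ballInv (ha : ‖a‖ < 1) {z : E} (hz : 1 - ⟪a, z⟫_ℂ ≠ 0) :
    1 + ⟪a, ballInv a z⟫_ℂ = (ballScale a : ℂ) ^ 2 * (1 - ⟪a, z⟫_ℂ)⁻¹ := by
  rw [ballInv, inner_smul_right, inner_ballStretch ha, inner_sub_right,
    inner_self_eq_one_sub_sq_ballScale ha]
  field_simp
  ring

theorem ballMap_ballInv (ha : ‖a‖ < 1) {z : E} (hz : 1 - ⟪a, z⟫_ℂ ≠ 0) :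
    ballMap a (ballInv a z) = z := by
  have hs := ballScale_pos ha
  have hs' : (ballScale a : ℂ) ≠ 0 := by exact_mod_cast hs.ne'
  rw [ballMap, one_add_inner_ballInv ha hz, ballInv, map_smul, ballShrink_ballStretch ha, smul_smul,
    smul_smul]
  have : ((ballScale a : ℂ) ^ 2 * (1 - ⟪a, z⟫_ℂ)⁻¹)⁻¹ *
      (1 - ⟪a, z⟫_ℂ)⁻¹ * (ballScale a : ℂ) ^ 2 = 1 := by
    field_simp
  rw [this, one_smul]
  abel

theorem one_sub_inner_ballMap (ha : ‖a‖ < 1) {w : E} (hw : 1 + ⟪a, w⟫_ℂ ≠ 0) :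
    1 - ⟪a, ballMap a w⟫_ℂ = (ballScale a : ℂ) ^ 2 * (1 + ⟪a, w⟫_ℂ)⁻¹ := by
  rw [ballMap, inner_add_right, inner_smul_right, inner_ballShrink ha,
    inner_self_eq_one_sub_sq_ballScale ha]
  field_simp
  ring

theorem ballInv_ballMap (ha : ‖a‖ < 1) {w : E} (hw : 1 + ⟪a, w⟫_ℂ ≠ 0) :
    ballInv a (ballMap a w) = w := by
  have hs := ballScale_pos ha
  have hs' : (ballScale a : ℂ) ≠ 0 := by exact_mod_cast hs.ne'
  rw [ballInv, one_sub_inner_ballMap ha hw, ballMap, add_sub_cancel_left, map_smul,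
    ballStretch_ballShrink ha, smul_smul, smul_smul]
  have : ((ballScale a : ℂ) ^ 2 * (1 + ⟪a, w⟫_ℂ)⁻¹)⁻¹ *
      (1 + ⟪a, w⟫_ℂ)⁻¹ * (ballScale a : ℂ) ^ 2 = 1 := by
    field_simp
  rw [this, one_smul]

theorem one_sub_norm_sq_ballMap (ha : ‖a‖ < 1) {w : E} (hw : 1 + ⟪a, w⟫_ℂ ≠ 0) :
    (1 - ‖ballMap a w‖ ^ 2) * ‖1 + ⟪a, w⟫_ℂ‖ ^ 2 = ballScale a ^ 2 * (1 - ‖w‖ ^ 2) := by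
  have h1 : ‖ballMap a w‖ ^ 2 * ‖1 + ⟪a, w⟫_ℂ‖ ^ 2 =
      ‖(1 + ⟪a, w⟫_ℂ) • a + ballShrink a w‖ ^ 2 := by
    rw [← mul_pow, mul_comm, ← norm_smul, ballMap, smul_add, smul_inv_smul₀ hw]
  rw [sub_mul, h1, norm_add_sq (𝕜 := ℂ) ((1 + ⟪a, w⟫_ℂ) • a), norm_sq_ballShrink ha, inner_smul_left,
    inner_ballShrink ha, norm_smul, ← Complex.ofReal_pow, sq_ballScale ha,
    mul_pow, ← Complex.normSq_eq_norm_sq, ← Complex.normSq_eq_norm_sq]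
  generalize ⟪a, w⟫_ℂ = c
  generalize ‖a‖ ^ 2 = d
  simp only [Complex.normSq_apply, map_add, map_one, RCLike.re_eq_complex_re, Complex.mul_re,
    Complex.mul_im, Complex.add_re, Complex.add_im, Complex.one_re, Complex.one_im,
    Complex.conj_re, Complex.conj_im, Complex.ofReal_re, Complex.ofReal_im]
  ring

theorem norm_ballMap_lt_one (ha : ‖a‖ < 1) {w : E} (hw : ‖w‖ < 1) : ‖ballMap a w‖ < 1 := by
  have hne := one_add_ne_zero_of_norm_lt_one (norm_inner_lt_one ha hw)
  have h := one_sub_norm_sq_ballMap ha hne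
  have hs := ballScale_pos ha
  have h1 : 0 < ballScale a ^ 2 * (1 - ‖w‖ ^ 2) := by
    have : 0 < 1 - ‖w‖ ^ 2 := by nlinarith [norm_nonneg w]
    positivity
  rw [← h] at h1
  have := pos_of_mul_pos_left h1 (by positivity)
  nlinarith [norm_nonneg (ballMap a w)]

theorem one_sub_norm_sq_ballInv (ha : ‖a‖ < 1) {z : E} (hz : 1 - ⟪a, z⟫_ℂ ≠ 0) :
    (1 - ‖ballInv a z‖ ^ 2) * ‖1 - ⟪a, z⟫_ℂ‖ ^ 2 = ballScale a ^ 2 * (1 - ‖z‖ ^ 2) := by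
  have hs := ballScale_pos ha
  have hs' : (ballScale a : ℂ) ≠ 0 := by exact_mod_cast hs.ne'
  have hw : 1 + ⟪a, ballInv a z⟫_ℂ ≠ 0 := by
    rw [one_add_inner_ballInv ha hz]
    positivity
  have h := one_sub_norm_sq_ballMap ha hw
  rw [ballMap_ballInv ha hz, one_add_inner_ballInv ha hz, norm_mul, norm_pow, Complex.norm_real,
    Real.norm_of_nonneg hs.le, norm_inv] at h
  have hn : ‖1 - ⟪a, z⟫_ℂ‖ ≠ 0 := norm_ne_zero_iff.2 hz
  have h' : ballScale a ^ 2 * ((1 - ‖ballInv a z‖ ^ 2) * ‖1 - ⟪a, z⟫_ℂ‖ ^ 2) =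
      ballScale a ^ 2 * (ballScale a ^ 2 * (1 - ‖z‖ ^ 2)) := by
    rw [← mul_assoc, ← h]
    field_simp
  exact mul_left_cancel₀ (by positivity) h'

theorem norm_ballInv_lt_one (ha : ‖a‖ < 1) {z : E} (hz : ‖z‖ < 1) : ‖ballInv a z‖ < 1 := by
  have hne := one_sub_ne_zero_of_norm_lt_one (norm_inner_lt_one ha hz)
  have h := one_sub_norm_sq_ballInv ha hne
  have hs := ballScale_pos ha
  have h1 : 0 < ballScale a ^ 2 * (1 - ‖z‖ ^ 2) := by
    have : 0 < 1 - ‖z‖ ^ 2 := by nlinarith [norm_nonneg z]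
    positivity
  rw [← h] at h1
  have := pos_of_mul_pos_left h1 (by positivity)
  nlinarith [norm_nonneg (ballInv a z)]

theorem ballInv_self (a : E) : ballInv a a = 0 := by simp [ballInv]

theorem ballMap_zero (a : E) : ballMap a 0 = a := by simp [ballMap]

theorem differentiableOn_ballMap (ha : ‖a‖ < 1) : DifferentiableOn ℂ (ballMap a) (ball 0 1) := by
  have h : DifferentiableOn ℂ (fun w : E => 1 + ⟪a, w⟫_ℂ) (ball 0 1) :=
    ((innerSL ℂ a).differentiable.const_add 1).differentiableOn
  exact ((h.inv fun w hw => one_add_ne_zero_of_norm_lt_one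
    (norm_inner_lt_one ha (mem_ball_zero_iff.1 hw))).smul
      (ballShrink a).differentiable.differentiableOn).const_add a

theorem differentiableOn_ballInv (ha : ‖a‖ < 1) : DifferentiableOn ℂ (ballInv a) (ball 0 1) := by
  have h : DifferentiableOn ℂ (fun w : E => 1 - ⟪a, w⟫_ℂ) (ball 0 1) :=
    ((innerSL ℂ a).differentiable.const_sub 1).differentiableOn
  exact (h.inv fun w hw => one_sub_ne_zero_of_norm_lt_one
    (norm_inner_lt_one ha (mem_ball_zero_iff.1 hw))).smul
      ((ballStretch a).differentiable.comp (differentiable_id.sub_const a)).differentiableOn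

end BallAutomorphism

section FixedPoint

variable {E : Type*} [NormedAddCommGroup E] [InnerProductSpace ℂ E]

theorem norm_ballInv_le_of_norm_le {ρ : ℝ} (hρ : ρ < 1) {x y : E} (hx : ‖x‖ ≤ ρ) (hy : ‖y‖ ≤ ρ) :
    ‖ballInv x y‖ ≤ Real.sqrt (1 - (1 - ρ ^ 2) ^ 2 / 4) := by
  have hx1 : ‖x‖ < 1 := hx.trans_lt hρ
  have hy1 : ‖y‖ < 1 := hy.trans_lt hρ
  have h := one_sub_norm_sq_ballInv hx1
    (one_sub_ne_zero_of_norm_lt_one (norm_inner_lt_one hx1 hy1))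
  have hn : ‖1 - ⟪x, y⟫_ℂ‖ ≤ 2 := by
    refine (norm_sub_le _ _).trans ?_
    rw [norm_one]
    linarith [norm_inner_lt_one hx1 hy1]
  have hlt := norm_ballInv_lt_one hx1 hy1
  have hn2 : ‖1 - ⟪x, y⟫_ℂ‖ ^ 2 ≤ 4 := by nlinarith [norm_nonneg (1 - ⟪x, y⟫_ℂ)]
  have hpos : 0 ≤ 1 - ‖ballInv x y‖ ^ 2 := by nlinarith [norm_nonneg (ballInv x y)]
  rw [sq_ballScale hx1] at h
  have hρ0 : 0 ≤ ρ := (norm_nonneg x).trans hx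
  have h1 : 1 - ρ ^ 2 ≤ 1 - ‖x‖ ^ 2 := by nlinarith [norm_nonneg x]
  have h2 : 1 - ρ ^ 2 ≤ 1 - ‖y‖ ^ 2 := by nlinarith [norm_nonneg y]
  have h0 : 0 ≤ 1 - ρ ^ 2 := by nlinarith
  apply Real.le_sqrt_of_sq_le
  nlinarith [mul_le_mul h1 h2 h0 (h0.trans h1), mul_le_mul_of_nonneg_left hn2 hpos]

theorem norm_sub_le_mul_norm_ballInv {ρ : ℝ} (hρ : ρ < 1) {x y : E} (hx : ‖x‖ ≤ ρ)
    (hy : ‖y‖ < 1) : ‖y - x‖ ≤ 2 / (1 - ρ ^ 2) * ‖ballInv x y‖ := by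
  have hx1 : ‖x‖ < 1 := hx.trans_lt hρ
  have hne := one_sub_ne_zero_of_norm_lt_one (norm_inner_lt_one hx1 hy)
  have hn : ‖1 - ⟪x, y⟫_ℂ‖ ≤ 2 := by
    refine (norm_sub_le _ _).trans ?_
    rw [norm_one]
    linarith [norm_inner_lt_one hx1 hy]
  have hs := ballScale_pos hx1
  have hρ0 : 0 ≤ ρ := (norm_nonneg x).trans hx
  have h0 : 0 < 1 - ρ ^ 2 := by nlinarith
  have h1 : 1 - ρ ^ 2 ≤ ballScale x ^ 2 := by
    rw [sq_ballScale hx1]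
    nlinarith [norm_nonneg x]
  have h2 : y - x = (1 + ⟪x, ballInv x y⟫_ℂ)⁻¹ • ballShrink x (ballInv x y) := by
    conv_lhs => rw [← ballMap_ballInv hx1 hne, ballMap, add_sub_cancel_left]
  rw [h2, norm_smul, one_add_inner_ballInv hx1 hne, norm_inv, norm_mul, norm_pow,
    Complex.norm_real, Real.norm_of_nonneg hs.le, norm_inv, mul_inv, inv_inv]
  refine mul_le_mul ?_ (norm_ballShrink_le hx1 _) (norm_nonneg _) (by positivity)
  rw [div_eq_inv_mul]
  exact mul_le_mul (inv_anti₀ h0 h1) hn (norm_nonneg _) (inv_nonneg.2 h0.le)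

theorem norm_ballInv_map_le {f : E → E} (hf : DifferentiableOn ℂ f (ball 0 1)) {ρ : ℝ}
    (hρ : ρ < 1) (hmaps : ∀ x ∈ ball (0 : E) 1, ‖f x‖ ≤ ρ) {x y : E} (hx : ‖x‖ < 1)
    (hy : ‖y‖ < 1) :
    ‖ballInv (f x) (f y)‖ ≤ Real.sqrt (1 - (1 - ρ ^ 2) ^ 2 / 4) * ‖ballInv x y‖ := by
  have hfx : ‖f x‖ < 1 := (hmaps x (mem_ball_zero_iff.2 hx)).trans_lt hρ
  have hm : Set.MapsTo (ballMap x) (ball (0 : E) 1) (ball 0 1) := fun w hw =>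
    mem_ball_zero_iff.2 (norm_ballMap_lt_one hx (mem_ball_zero_iff.1 hw))
  have hfm : Set.MapsTo f (ball (0 : E) 1) (ball 0 1) := fun w hw =>
    mem_ball_zero_iff.2 ((hmaps w hw).trans_lt hρ)
  have hd : DifferentiableOn ℂ (fun w => ballInv (f x) (f (ballMap x w))) (ball 0 1) :=
    (differentiableOn_ballInv hfx).comp (hf.comp (differentiableOn_ballMap hx) hm) (hfm.comp hm)
  have h0 : ballInv (f x) (f (ballMap x 0)) = 0 := by rw [ballMap_zero, ballInv_self]
  have key := Complex.dist_le_div_mul_dist_of_mapsTo_ball hd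
    (R₂ := Real.sqrt (1 - (1 - ρ ^ 2) ^ 2 / 4)) (z := ballInv x y) (fun w hw => by
      rw [h0, mem_closedBall_zero_iff]
      exact norm_ballInv_le_of_norm_le hρ (hmaps x (mem_ball_zero_iff.2 hx)) (hmaps _ (hm hw)))
    (mem_ball_zero_iff.2 (norm_ballInv_lt_one hx hy))
  rwa [h0, dist_zero_right, dist_zero_right, div_one,
    ballMap_ballInv hx (one_sub_ne_zero_of_norm_lt_one (norm_inner_lt_one hx hy))] at key

theorem existsUnique_fixedPoint_unitBall [CompleteSpace E] {f : E → E}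
    (hf : DifferentiableOn ℂ f (ball 0 1)) {ρ : ℝ} (hρ : ρ < 1)
    (hmaps : ∀ x ∈ ball (0 : E) 1, ‖f x‖ ≤ ρ) : ∃! x : E, x ∈ ball (0 : E) 1 ∧ f x = x := by
  have hρ0 : 0 ≤ ρ := (norm_nonneg _).trans (hmaps 0 (by simp))
  set k := Real.sqrt (1 - (1 - ρ ^ 2) ^ 2 / 4) with hk
  have hk1 : k < 1 := by
    rw [hk, Real.sqrt_lt' one_pos]
    have : 0 < 1 - ρ ^ 2 := by nlinarith
    nlinarith
  have hρball : ∀ {x : E}, ‖x‖ ≤ ρ → x ∈ ball (0 : E) 1 := fun hx =>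
    mem_ball_zero_iff.2 (hx.trans_lt hρ)
  let u : ℕ → E := fun m => f^[m] 0
  have hu : ∀ m, ‖u m‖ ≤ ρ := by
    intro m
    induction m with
    | zero => simpa [u] using hρ0
    | succ m ih =>
      simp only [u, Function.iterate_succ_apply']
      exact hmaps _ (hρball ih)
  have hstep : ∀ m, ‖ballInv (u m) (u (m + 1))‖ ≤ k ^ m := by
    intro m
    induction m with
    | zero =>
      rw [pow_zero]
      exact (norm_ballInv_lt_one ((hu 0).trans_lt hρ) ((hu 1).trans_lt hρ)).le
    | succ m ih =>
      have h := norm_ballInv_map_le hf hρ hmaps ((hu m).trans_lt hρ) ((hu (m + 1)).trans_lt hρ)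
      simp only [u] at h ih ⊢
      rw [← Function.iterate_succ_apply' f, ← Function.iterate_succ_apply' f] at h
      refine h.trans ?_
      rw [pow_succ' k m]
      exact mul_le_mul_of_nonneg_left ih (Real.sqrt_nonneg _)
  have hc : CauchySeq u := by
    refine cauchySeq_of_le_geometric k (2 / (1 - ρ ^ 2)) hk1 fun m => ?_
    rw [dist_comm, dist_eq_norm]
    refine (norm_sub_le_mul_norm_ballInv hρ (hu m) ((hu (m + 1)).trans_lt hρ)).trans ?_
    have : 0 < 1 - ρ ^ 2 := by nlinarith
    gcongr
    exact hstep m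
  obtain ⟨p, hp⟩ := cauchySeq_tendsto_of_complete hc
  have hpρ : ‖p‖ ≤ ρ := le_of_tendsto hp.norm (Filter.Eventually.of_forall hu)
  have hcont : ContinuousAt f p :=
    (hf.continuousOn).continuousAt (isOpen_ball.mem_nhds (hρball hpρ))
  have hfp : f p = p := by
    refine tendsto_nhds_unique ?_ (hp.comp (Filter.tendsto_add_atTop_nat 1))
    refine (hcont.tendsto.comp hp).congr fun m => ?_
    simp [u, Function.iterate_succ_apply']
  refine ⟨p, ⟨hρball hpρ, hfp⟩, fun q hq => ?_⟩
  have hq1 : ‖q‖ < 1 := mem_ball_zero_iff.1 hq.1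
  have h := norm_ballInv_map_le hf hρ hmaps (hpρ.trans_lt hρ) hq1
  rw [hfp, hq.2] at h
  have hz : ‖ballInv p q‖ = 0 := by nlinarith [norm_nonneg (ballInv p q)]
  have h' := norm_sub_le_mul_norm_ballInv hρ hpρ hq1
  rw [hz, mul_zero] at h'
  exact sub_eq_zero.1 (norm_le_zero_iff.1 h')

/-- The Earle–Hamilton fixed point theorem for balls of a Hilbert space. -/
theorem existsUnique_fixedPoint_ball [CompleteSpace E] {f : E → E} {r : ℝ} (hr : 0 < r)
    (hf : DifferentiableOn ℂ f (ball 0 r)) {ρ : ℝ} (hρ : ρ < r)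
    (hmaps : ∀ x ∈ ball (0 : E) r, ‖f x‖ ≤ ρ) : ∃! x : E, x ∈ ball (0 : E) r ∧ f x = x := by
  have hr' : (r : ℂ) ≠ 0 := by exact_mod_cast hr.ne'
  have hnr : ‖(r : ℂ)‖ = r := by rw [Complex.norm_real, Real.norm_of_nonneg hr.le]
  have hmem : ∀ x : E, (r : ℂ) • x ∈ ball (0 : E) r ↔ x ∈ ball (0 : E) 1 := by
    intro x
    rw [mem_ball_zero_iff, mem_ball_zero_iff, norm_smul, hnr]
    exact mul_lt_iff_lt_one_right hr
  obtain ⟨p, ⟨hp, hfp⟩, huniq⟩ := existsUnique_fixedPoint_unitBall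
    (f := fun x : E => (r : ℂ)⁻¹ • f ((r : ℂ) • x)) (ρ := ρ / r)
    ((hf.comp (differentiable_id.const_smul (r : ℂ)).differentiableOn
      fun x hx => (hmem x).2 hx).const_smul _)
    ((div_lt_one hr).2 hρ) (fun x hx => by
      rw [norm_smul, norm_inv, hnr, div_eq_inv_mul]
      exact mul_le_mul_of_nonneg_left (hmaps _ ((hmem x).2 hx)) (inv_nonneg.2 hr.le))
  refine ⟨(r : ℂ) • p, ⟨(hmem p).2 hp, ?_⟩, fun q hq => ?_⟩
  · exact (inv_smul_eq_iff₀ hr').1 hfp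
  · rw [← huniq ((r : ℂ)⁻¹ • q) ⟨(hmem _).1 (by rw [smul_inv_smul₀ hr']; exact hq.1), ?_⟩,
      smul_inv_smul₀ hr']
    simp only [smul_inv_smul₀ hr', hq.2]

end FixedPoint

section TaylorCoefficient

variable {F : Type*} [NormedAddCommGroup F] [NormedSpace ℂ F]

theorem sq_lintegral_enorm_le {X G : Type*} [MeasurableSpace X] [NormedAddCommGroup G]
    {μ : Measure X} {h : X → G} (hh : AEStronglyMeasurable h μ) :
    (∫⁻ x, ‖h x‖ₑ ∂μ) ^ 2 ≤ μ Set.univ * ∫⁻ x, ‖h x‖ₑ ^ 2 ∂μ := by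
  have h1 := eLpNorm_le_eLpNorm_mul_rpow_measure_univ (p := 1) (q := 2) (μ := μ)
    (by norm_num) hh
  rw [eLpNorm_one_eq_lintegral_enorm,
    eLpNorm_eq_lintegral_rpow_enorm_toReal (by norm_num) (by norm_num)] at h1
  have h2 := pow_le_pow_left' h1 2
  refine h2.trans (le_of_eq ?_)
  rw [mul_pow, ← ENNReal.rpow_natCast, ← ENNReal.rpow_natCast, ← ENNReal.rpow_mul,
    ← ENNReal.rpow_mul, mul_comm]
  norm_num

/-- The `k`-th Taylor coefficient at `0` is bounded by the mean square on the unit circle. -/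
theorem two_pi_mul_sq_enorm_taylorCoeff_le [CompleteSpace F] {g : ℂ → F}
    (hg : DifferentiableOn ℂ g (closedBall 0 1)) (k : ℕ) :
    ENNReal.ofReal (2 * Real.pi) * ‖(k.factorial : ℂ)⁻¹ • iteratedDeriv k g 0‖ₑ ^ 2 ≤
      ∫⁻ t in Set.Ioc 0 (2 * Real.pi), ‖g (circleMap 0 1 t)‖ₑ ^ 2 := by
  have hpi : 0 < 2 * Real.pi := Real.two_pi_pos
  have hC := hg.circleIntegral_one_div_sub_center_pow_smul one_pos k
  have hc : (2 * Real.pi * Complex.I : ℂ) ≠ 0 := by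
    simp [Real.pi_ne_zero]
  have hC' : (k.factorial : ℂ)⁻¹ • iteratedDeriv k g 0 =
      (2 * Real.pi * Complex.I : ℂ)⁻¹ • ∮ z in C(0, 1), (1 / (z - 0) ^ (k + 1)) • g z := by
    rw [hC, smul_smul]
    congr 1
    field_simp
  have hcont : Continuous fun t : ℝ => g (circleMap 0 1 t) :=
    hg.continuousOn.comp_continuous (continuous_circleMap 0 1) fun t =>
      sphere_subset_closedBall (circleMap_mem_sphere 0 zero_le_one t)
  have hnorm : ENNReal.ofReal (2 * Real.pi) * ‖(k.factorial : ℂ)⁻¹ • iteratedDeriv k g 0‖ₑ ≤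
      ∫⁻ t in Set.Ioc 0 (2 * Real.pi), ‖g (circleMap 0 1 t)‖ₑ := by
    have e1 : ‖(2 * Real.pi * Complex.I : ℂ)‖ₑ = ENNReal.ofReal (2 * Real.pi) := by
      rw [← ofReal_norm]
      simp [abs_of_pos Real.pi_pos]
    rw [hC', enorm_smul, enorm_inv hc, e1, ← mul_assoc,
      ENNReal.mul_inv_cancel (by simpa using hpi) ENNReal.ofReal_ne_top, one_mul, circleIntegral,
      intervalIntegral.integral_of_le hpi.le]
    refine (enorm_integral_le_lintegral_enorm _).trans (lintegral_mono fun t => le_of_eq ?_)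
    rw [enorm_smul, enorm_smul]
    have : ‖deriv (circleMap 0 1) t‖ₑ * ‖1 / (circleMap 0 1 t - 0) ^ (k + 1)‖ₑ = 1 := by
      rw [← ofReal_norm, ← ofReal_norm, ← ENNReal.ofReal_mul (norm_nonneg _)]
      simp
    rw [← mul_assoc, this, one_mul]
  have hCS := sq_lintegral_enorm_le
    (μ := volume.restrict (Set.Ioc 0 (2 * Real.pi))) hcont.aestronglyMeasurable
  have h2 := (pow_le_pow_left' hnorm 2).trans hCS
  rw [mul_pow, sq (ENNReal.ofReal _), mul_assoc] at h2
  simp only [Measure.restrict_apply_univ, Real.volume_Ioc, sub_zero] at h2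
  exact (ENNReal.mul_le_mul_iff_right (by simpa using hpi) ENNReal.ofReal_ne_top).1 h2

theorem iteratedDeriv_comp_const_smul_zero {φ : ℂ → F} [CompleteSpace F]
    (hφ : DifferentiableOn ℂ φ (ball 0 1)) {c : ℂ} (hc : ‖c‖ < 1) (k : ℕ) :
    iteratedDeriv k (fun ζ => φ (c * ζ)) 0 = c ^ k • iteratedDeriv k φ 0 := by
  have h0 : (0 : ℂ) ∈ ball (0 : ℂ) 1 := mem_ball_self one_pos
  have h := iteratedDerivWithin_comp_const_smul (n := k) h0 isOpen_ball.uniqueDiffOn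
    (hφ.contDiffOn isOpen_ball) c (fun z hz => by
      rw [mem_ball_zero_iff] at hz ⊢
      rw [norm_mul]
      nlinarith [norm_nonneg c, norm_nonneg z])
  rwa [iteratedDerivWithin_of_isOpen isOpen_ball h0, mul_zero,
    iteratedDerivWithin_of_isOpen isOpen_ball h0] at h

end TaylorCoefficient

section Averaging

open scoped ENNReal

variable {n : ℕ}

theorem LinearIsometryEquiv.measurePreserving_complex (T : En n ≃ₗᵢ[ℂ] En n) :
    MeasurePreserving T (volume : Measure (En n)) volume :=
  LinearIsometryEquiv.measurePreserving
    ({ T.toLinearEquiv.restrictScalars ℝ with norm_map' := T.norm_map } : En n ≃ₗᵢ[ℝ] En n)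

theorem lintegral_le_lintegral_of_le_average {T : ℝ → En n → En n}
    (hT : Measurable fun p : En n × ℝ => T p.2 p.1)
    (hT' : ∀ t, MeasurePreserving (T t) (volume : Measure (En n)) volume)
    {G H : En n → ℝ≥0∞} (hG : Measurable G)
    (hle : ∀ w, ENNReal.ofReal (2 * Real.pi) * H w ≤
      ∫⁻ t in Set.Ioc 0 (2 * Real.pi), G (T t w)) :
    ∫⁻ w, H w ≤ ∫⁻ w, G w := by
  have hpi : 0 < 2 * Real.pi := Real.two_pi_pos
  have h : ENNReal.ofReal (2 * Real.pi) * ∫⁻ w, H w ≤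
      ENNReal.ofReal (2 * Real.pi) * ∫⁻ w, G w := by
    calc ENNReal.ofReal (2 * Real.pi) * ∫⁻ w, H w
        = ∫⁻ w, ENNReal.ofReal (2 * Real.pi) * H w :=
          (lintegral_const_mul' _ _ ENNReal.ofReal_ne_top).symm
      _ ≤ ∫⁻ w, ∫⁻ t in Set.Ioc 0 (2 * Real.pi), G (T t w) := lintegral_mono hle
      _ = ∫⁻ t in Set.Ioc 0 (2 * Real.pi), ∫⁻ w, G (T t w) :=
          lintegral_lintegral_swap (hG.comp hT).aemeasurable
      _ = ∫⁻ _ in Set.Ioc 0 (2 * Real.pi), ∫⁻ w, G w :=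
          lintegral_congr fun t => (hT' t).lintegral_comp hG
      _ = _ := by
          rw [lintegral_const, Measure.restrict_apply_univ, Real.volume_Ioc, sub_zero, mul_comm]
  exact (ENNReal.mul_le_mul_iff_right (by simpa using hpi) ENNReal.ofReal_ne_top).1 h

/-- Scaling by `ζ` on the orthogonal complement of `u`. -/
def scaleOrthogonal (u : En n) (ζ : ℂ) (w : En n) : En n :=
  ⟪u, w⟫_ℂ • u + ζ • (w - ⟪u, w⟫_ℂ • u)

variable {u : En n}

theorem inner_sub_inner_smul (hu : ‖u‖ = 1) (w : En n) : ⟪u, w - ⟪u, w⟫_ℂ • u⟫_ℂ = 0 := by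
  rw [inner_sub_right, inner_smul_right, inner_self_eq_norm_sq_to_K, hu]
  simp

theorem norm_sq_scaleOrthogonal (hu : ‖u‖ = 1) (ζ : ℂ) (w : En n) :
    ‖scaleOrthogonal u ζ w‖ ^ 2 =
      ‖⟪u, w⟫_ℂ‖ ^ 2 + ‖ζ‖ ^ 2 * ‖w - ⟪u, w⟫_ℂ • u‖ ^ 2 := by
  rw [scaleOrthogonal, norm_add_sq (𝕜 := ℂ), inner_smul_right, inner_smul_left,
    inner_sub_inner_smul hu, norm_smul, norm_smul, hu]
  simp [mul_pow]

theorem norm_sq_eq_inner_add_sub (hu : ‖u‖ = 1) (w : En n) :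
    ‖w‖ ^ 2 = ‖⟪u, w⟫_ℂ‖ ^ 2 + ‖w - ⟪u, w⟫_ℂ • u‖ ^ 2 := by
  simpa [scaleOrthogonal] using norm_sq_scaleOrthogonal hu 1 w

theorem norm_scaleOrthogonal_le (hu : ‖u‖ = 1) {ζ : ℂ} (hζ : ‖ζ‖ ≤ 1) (w : En n) :
    ‖scaleOrthogonal u ζ w‖ ≤ ‖w‖ := by
  refine le_of_sq_le_sq ?_ (norm_nonneg _)
  rw [norm_sq_scaleOrthogonal hu, norm_sq_eq_inner_add_sub hu w]
  have : ‖ζ‖ ^ 2 ≤ 1 := pow_le_one₀ (norm_nonneg _) hζ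
  nlinarith [sq_nonneg ‖w - ⟪u, w⟫_ℂ • u‖]

theorem norm_scaleOrthogonal (hu : ‖u‖ = 1) {ζ : ℂ} (hζ : ‖ζ‖ = 1) (w : En n) :
    ‖scaleOrthogonal u ζ w‖ = ‖w‖ := by
  refine (sq_eq_sq₀ (norm_nonneg _) (norm_nonneg _)).1 ?_
  rw [norm_sq_scaleOrthogonal hu, norm_sq_eq_inner_add_sub hu w, hζ]
  ring

theorem measurePreserving_scaleOrthogonal (hu : ‖u‖ = 1) {ζ : ℂ} (hζ : ‖ζ‖ = 1) :
    MeasurePreserving (scaleOrthogonal u ζ) (volume : Measure (En n)) volume :=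
  LinearIsometryEquiv.measurePreserving_complex (LinearIsometry.toLinearIsometryEquiv
    { toFun := scaleOrthogonal u ζ
      map_add' := fun x y => by
        simp only [scaleOrthogonal, inner_add_right]
        module
      map_smul' := fun c x => by
        simp only [scaleOrthogonal, inner_smul_right, RingHom.id_apply]
        module
      norm_map' := norm_scaleOrthogonal hu hζ } rfl)

theorem measurePreserving_unimodular_smul {ζ : ℂ} (hζ : ‖ζ‖ = 1) :
    MeasurePreserving (fun w : En n => ζ • w) (volume : Measure (En n)) volume :=
  LinearIsometryEquiv.measurePreserving_complex (LinearIsometry.toLinearIsometryEquiv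
    { toFun := fun w => ζ • w
      map_add' := smul_add ζ
      map_smul' := fun c x => smul_comm ζ c x
      norm_map' := fun x => show ‖ζ • x‖ = ‖x‖ by rw [norm_smul, hζ, one_mul] } rfl)

theorem measurable_indicator_enorm_sq {G : Type*} [NormedAddCommGroup G] {h : En n → G} (hh : ContinuousOn h (ball 0 1)) :
    Measurable ((ball (0 : En n) 1).indicator fun w => ‖h w‖ₑ ^ 2) := by
  classical
  rw [← Set.piecewise_eq_indicator]
  exact ((ENNReal.continuous_pow 2).comp_continuousOn
    (continuous_enorm.comp_continuousOn hh)).measurable_piecewise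
    continuousOn_const isOpen_ball.measurableSet

theorem norm_inner_smul_lt_one (hu : ‖u‖ = 1) {w : En n} (hw : ‖w‖ < 1) :
    ‖⟪u, w⟫_ℂ • u‖ < 1 := by
  rw [norm_smul, hu, mul_one]
  exact (norm_inner_le_norm u w).trans_lt (by rwa [hu, one_mul])

variable {G : Type*} [NormedAddCommGroup G] [NormedSpace ℂ G] [CompleteSpace G] {F : En n → G}

theorem lintegral_enorm_sq_inner_smul_le (hu : ‖u‖ = 1) (hF : DifferentiableOn ℂ F (ball 0 1)) :
    ∫⁻ w in ball (0 : En n) 1, ‖F (⟪u, w⟫_ℂ • u)‖ₑ ^ 2 ≤ ∫⁻ w in ball (0 : En n) 1, ‖F w‖ₑ ^ 2 := by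
  rw [← lintegral_indicator measurableSet_ball, ← lintegral_indicator measurableSet_ball]
  refine lintegral_le_lintegral_of_le_average
    (T := fun t => scaleOrthogonal u (circleMap 0 1 t)) ?_
    (fun t => measurePreserving_scaleOrthogonal hu (by simp))
    (measurable_indicator_enorm_sq hF.continuousOn) fun w => ?_
  · apply Continuous.measurable
    simp only [scaleOrthogonal]
    have := continuous_circleMap 0 1
    fun_prop
  by_cases hw : w ∈ ball (0 : En n) 1
  · have hw1 := mem_ball_zero_iff.1 hw
    have hmaps : ∀ ζ ∈ closedBall (0 : ℂ) 1, scaleOrthogonal u ζ w ∈ ball (0 : En n) 1 :=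
      fun ζ hζ => mem_ball_zero_iff.2
        ((norm_scaleOrthogonal_le hu (mem_closedBall_zero_iff.1 hζ) w).trans_lt hw1)
    have h := two_pi_mul_sq_enorm_taylorCoeff_le (g := fun ζ => F (scaleOrthogonal u ζ w))
      (hF.comp (by unfold scaleOrthogonal; fun_prop) hmaps) 0
    rw [Set.indicator_of_mem hw]
    simp only [Nat.factorial_zero, Nat.cast_one, inv_one, iteratedDeriv_zero, one_smul] at h
    rw [scaleOrthogonal, zero_smul, add_zero] at h
    refine h.trans (le_of_eq (lintegral_congr fun t => ?_))
    rw [Set.indicator_of_mem (hmaps _ (sphere_subset_closedBall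
      (circleMap_mem_sphere 0 zero_le_one t)))]
  · rw [Set.indicator_of_notMem hw, mul_zero]
    exact zero_le

theorem enorm_sq_taylorCoeff_mul_lintegral_le (hu : ‖u‖ = 1)
    (hF : DifferentiableOn ℂ F (ball 0 1)) (k : ℕ) :
    ‖(k.factorial : ℂ)⁻¹ • iteratedDeriv k (fun ζ : ℂ => F (ζ • u)) 0‖ₑ ^ 2 *
        ∫⁻ w in ball (0 : En n) 1, (‖⟪u, w⟫_ℂ‖ₑ ^ 2) ^ k ≤
      ∫⁻ w in ball (0 : En n) 1, ‖F w‖ₑ ^ 2 := by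
  refine le_trans ?_ (lintegral_enorm_sq_inner_smul_le hu hF)
  set c := (k.factorial : ℂ)⁻¹ • iteratedDeriv k (fun ζ : ℂ => F (ζ • u)) 0 with hc
  have hφ : DifferentiableOn ℂ (fun ζ : ℂ => F (ζ • u)) (ball 0 1) :=
    hF.comp (by fun_prop) fun ζ hζ => by
      rw [mem_ball_zero_iff] at hζ ⊢
      rwa [norm_smul, hu, mul_one]
  have hcont : ContinuousOn (fun w : En n => F (⟪u, w⟫_ℂ • u)) (ball 0 1) :=
    hF.continuousOn.comp (by fun_prop) fun w hw =>
      mem_ball_zero_iff.2 (norm_inner_smul_lt_one hu (mem_ball_zero_iff.1 hw))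
  rw [← lintegral_const_mul' _ _ (by finiteness), ← lintegral_indicator measurableSet_ball,
    ← lintegral_indicator measurableSet_ball]
  refine lintegral_le_lintegral_of_le_average (T := fun t w => circleMap 0 1 t • w) ?_
    (fun t => measurePreserving_unimodular_smul (by simp))
    (measurable_indicator_enorm_sq hcont) fun w => ?_
  · apply Continuous.measurable
    have := continuous_circleMap 0 1
    fun_prop
  by_cases hw : w ∈ ball (0 : En n) 1
  · have hw1 := mem_ball_zero_iff.1 hw
    have hz : ‖⟪u, w⟫_ℂ‖ < 1 := by
      simpa [norm_smul, hu] using norm_inner_smul_lt_one hu hw1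
    have h := two_pi_mul_sq_enorm_taylorCoeff_le (g := fun ζ => F ((⟪u, w⟫_ℂ * ζ) • u))
      (hφ.comp (by fun_prop) fun ζ hζ => by
        rw [mem_closedBall_zero_iff] at hζ
        rw [mem_ball_zero_iff, norm_mul]
        nlinarith [norm_nonneg ζ, norm_nonneg ⟪u, w⟫_ℂ]) k
    rw [iteratedDeriv_comp_const_smul_zero hφ hz, smul_comm, ← hc] at h
    rw [Set.indicator_of_mem hw]
    refine (le_of_eq ?_).trans (h.trans (le_of_eq (lintegral_congr fun t => ?_)))
    · rw [enorm_smul (_ ^ k) c, enorm_pow, mul_pow]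
      ring
    · rw [Set.indicator_of_mem, inner_smul_right, mul_comm]
      rw [mem_ball_zero_iff, norm_smul]
      simpa using hw1
  · rw [Set.indicator_of_notMem hw, mul_zero]
    exact zero_le

end Averaging

section Moments

variable {n : ℕ} {u : En n}

theorem integral_ball_norm_sq (hn : n ≠ 0) :
    ∫ w in ball (0 : En n) 1, ‖w‖ ^ 2 =
      n / (n + 1) * (volume : Measure (En n)).real (ball 0 1) := by
  have : NeZero n := ⟨hn⟩
  have hfin : Module.finrank ℝ (En n) = 2 * n := by
    rw [finrank_real_of_complex]; simp
  have h := integral_fun_norm_addHaar (volume : Measure (En n))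
    ((Set.Iio (1 : ℝ)).indicator fun y => y ^ 2)
  have e1 : (fun x : En n => (Set.Iio (1 : ℝ)).indicator (fun y => y ^ 2) ‖x‖) =
      (ball (0 : En n) 1).indicator fun w => ‖w‖ ^ 2 := by
    funext x
    by_cases hx : ‖x‖ < 1 <;> simp [Set.indicator, hx]
  rw [e1, integral_indicator measurableSet_ball, hfin] at h
  have e2 : ∫ y in Set.Ioi (0 : ℝ), y ^ (2 * n - 1) •
      (Set.Iio (1 : ℝ)).indicator (fun y => y ^ 2) y = 1 / (2 * n + 2) := by
    have : (fun y : ℝ => y ^ (2 * n - 1) • (Set.Iio (1 : ℝ)).indicator (fun y => y ^ 2) y) =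
        (Set.Iio (1 : ℝ)).indicator fun y => y ^ (2 * n + 1) := by
      funext y
      by_cases hy : y < 1
      · simp only [Set.indicator, Set.mem_Iio, hy, if_true, smul_eq_mul]
        rw [← pow_add]
        congr 1
        lia
      · simp [Set.indicator, hy]
    rw [this, setIntegral_indicator measurableSet_Iio, Set.Ioi_inter_Iio,
      ← integral_Ioc_eq_integral_Ioo, ← intervalIntegral.integral_of_le zero_le_one,
      integral_pow]
    push_cast
    ring
  rw [h, e2]
  simp only [nsmul_eq_mul, smul_eq_mul]
  push_cast
  field_simp

theorem integral_ball_norm_inner_sq_eq_coord (hu : ‖u‖ = 1) (i : Fin n) :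
    ∫ w in ball (0 : En n) 1, ‖⟪u, w⟫_ℂ‖ ^ 2 = ∫ w in ball (0 : En n) 1, ‖w i‖ ^ 2 := by
  obtain ⟨b, hb⟩ := Orthonormal.exists_orthonormalBasis_extension_of_card_eq
    (𝕜 := ℂ) (ι := Fin n) (E := En n) (v := fun _ => u) (s := {i}) (by simp) (by
      refine ⟨fun j => by simpa using hu, fun j k hjk => ?_⟩
      exact absurd (Subsingleton.elim j k) hjk)
  have hb' : b i = u := hb i rfl
  have hmp := LinearIsometryEquiv.measurePreserving_complex b.repr
  have h := hmp.setIntegral_preimage_emb b.repr.toHomeomorph.measurableEmbedding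
    (fun w : En n => ‖w i‖ ^ 2) (ball 0 1)
  rw [← h]
  have e1 : b.repr ⁻¹' ball (0 : En n) 1 = ball 0 1 := by
    ext w
    simp
  rw [e1]
  simp only [b.repr_apply_apply, hb']

theorem integrableOn_ball_of_continuous {g : En n → ℝ} (hg : Continuous g) :
    IntegrableOn g (ball (0 : En n) 1) := by
  exact (hg.continuousOn.integrableOn_compact (isCompact_closedBall 0 1)).mono_set
    ball_subset_closedBall

theorem integral_ball_norm_inner_sq (hu : ‖u‖ = 1) :
    ∫ w in ball (0 : En n) 1, ‖⟪u, w⟫_ℂ‖ ^ 2 =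
      (volume : Measure (En n)).real (ball 0 1) / (n + 1) := by
  have hn : n ≠ 0 := by
    rintro rfl
    rw [Subsingleton.elim u 0] at hu
    simp at hu
  have h1 := integral_ball_norm_sq hn
  have h2 : ∫ w in ball (0 : En n) 1, ‖w‖ ^ 2 = ∑ i, ∫ w in ball (0 : En n) 1, ‖w i‖ ^ 2 := by
    rw [← integral_finsetSum _ fun i _ => integrableOn_ball_of_continuous (by fun_prop)]
    simp only [EuclideanSpace.norm_sq_eq]
  rw [h1, Finset.sum_congr rfl fun i _ => (integral_ball_norm_inner_sq_eq_coord hu i).symm] at h2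
  simp only [Finset.sum_const, Finset.card_univ, Fintype.card_fin, nsmul_eq_mul] at h2
  have hn' : (n : ℝ) ≠ 0 := by exact_mod_cast hn
  rw [div_mul_eq_mul_div, mul_div_assoc] at h2
  exact (mul_left_cancel₀ hn' h2).symm

theorem div_pow_le_integral_ball_norm_inner_sq_pow (hu : ‖u‖ = 1) (k : ℕ) :
    (volume : Measure (En n)).real (ball 0 1) / (n + 1) ^ k ≤
      ∫ w in ball (0 : En n) 1, (‖⟪u, w⟫_ℂ‖ ^ 2) ^ k := by
  have hvol : 0 < (volume : Measure (En n)).real (ball 0 1) :=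
    ENNReal.toReal_pos (measure_ball_pos _ _ one_pos).ne' measure_ball_lt_top.ne
  have h := ConvexOn.map_set_average_le (μ := (volume : Measure (En n))) (t := ball (0 : En n) 1)
    (f := fun w => ‖⟪u, w⟫_ℂ‖ ^ 2) (convexOn_pow k)
    (continuous_pow k).continuousOn isClosed_Ici (measure_ball_pos _ _ one_pos).ne'
    measure_ball_lt_top.ne (Filter.Eventually.of_forall fun w =>
      Set.mem_Ici.2 (sq_nonneg _))
    (integrableOn_ball_of_continuous (by fun_prop))
    (integrableOn_ball_of_continuous (by fun_prop))
  rw [setAverage_eq, setAverage_eq, integral_ball_norm_inner_sq hu] at h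
  simp only [smul_eq_mul] at h
  have e : ((volume : Measure (En n)).real (ball 0 1))⁻¹ *
      ((volume : Measure (En n)).real (ball 0 1) / (n + 1)) = 1 / (n + 1) := by
    field_simp
  rw [e, inv_mul_eq_div, le_div_iff₀ hvol, div_pow, one_pow] at h
  refine le_trans (le_of_eq ?_) h
  ring

theorem volume_real_unitBall (hn : n ≠ 0) :
    (volume : Measure (En n)).real (ball 0 1) = Real.pi ^ n / n.factorial := by
  have : NeZero n := ⟨hn⟩
  have hfin : Module.finrank ℝ (En n) = 2 * n := by
    rw [finrank_real_of_complex]; simp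
  rw [measureReal_def, InnerProductSpace.volume_ball_of_dim_even hfin]
  simp
  positivity

end Moments

section UnitBallEstimates

variable {n : ℕ} {G : Type*} [NormedAddCommGroup G] {F : En n → G}

theorem A2Norm_nonneg {ω : En n} {R : ℝ} : 0 ≤ A2Norm ω R F := Real.sqrt_nonneg _

theorem sq_A2Norm {ω : En n} {R : ℝ} (hR : 0 ≤ R) : A2Norm ω R F ^ 2 =
    ((n.factorial : ℝ) / (Real.pi ^ n * R ^ (2 * n))) * ∫ z in ball ω R, ‖F z‖ ^ 2 :=
  Real.sq_sqrt (mul_nonneg (by positivity) (integral_nonneg fun _ => sq_nonneg _))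

theorem lintegral_enorm_pow_eq_ofReal {X E' : Type*} [MeasurableSpace X] {μ : Measure X}
    [NormedAddCommGroup E'] {g : X → E'} {k : ℕ} (hg : Integrable (fun x => ‖g x‖ ^ k) μ) :
    ∫⁻ x, ‖g x‖ₑ ^ k ∂μ = ENNReal.ofReal (∫ x, ‖g x‖ ^ k ∂μ) := by
  rw [ofReal_integral_eq_lintegral_ofReal hg (Filter.Eventually.of_forall fun x => by positivity)]
  refine lintegral_congr fun x => ?_
  rw [ENNReal.ofReal_pow (norm_nonneg _), ofReal_norm]

variable [NormedSpace ℂ G]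

theorem differentiableOn_comp_smul (hF : DifferentiableOn ℂ F (ball 0 1)) {u : En n}
    (hu : ‖u‖ = 1) : DifferentiableOn ℂ (fun ζ : ℂ => F (ζ • u)) (ball 0 1) :=
  hF.comp (by fun_prop) fun ζ hζ => by
    rw [mem_ball_zero_iff] at hζ ⊢
    rwa [norm_smul, hu, mul_one]

theorem deriv_comp_smul_zero (hF : DifferentiableOn ℂ F (ball 0 1)) (u : En n) :
    deriv (fun ζ : ℂ => F (ζ • u)) 0 = fderiv ℂ F 0 u := by
  have h1 : HasFDerivAt F (fderiv ℂ F 0) ((0 : ℂ) • u) := by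
    rw [zero_smul]
    exact (hF.differentiableAt (ball_mem_nhds _ one_pos)).hasFDerivAt
  have h2 : HasDerivAt (fun ζ : ℂ => ζ • u) u 0 := by
    simpa using (hasDerivAt_id (0 : ℂ)).smul_const u
  exact (h1.comp_hasDerivAt 0 h2).deriv

variable [CompleteSpace G]

theorem norm_taylorCoeff_le (hn : n ≠ 0) (hF : DifferentiableOn ℂ F (ball 0 1))
    (hF2 : IntegrableOn (fun w => ‖F w‖ ^ 2) (ball 0 1)) {u : En n} (hu : ‖u‖ = 1) (k : ℕ) :
    ‖(k.factorial : ℂ)⁻¹ • iteratedDeriv k (fun ζ : ℂ => F (ζ • u)) 0‖ ≤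
      A2Norm 0 1 F * √(n + 1) ^ k := by
  set c := (k.factorial : ℂ)⁻¹ • iteratedDeriv k (fun ζ : ℂ => F (ζ • u)) 0
  have hvol : 0 < (volume : Measure (En n)).real (ball 0 1) :=
    ENNReal.toReal_pos (measure_ball_pos _ _ one_pos).ne' measure_ball_lt_top.ne
  have h := enorm_sq_taylorCoeff_mul_lintegral_le hu hF k
  have hpow := div_pow_le_integral_ball_norm_inner_sq_pow hu k
  simp only [← pow_mul] at h hpow
  rw [lintegral_enorm_pow_eq_ofReal hF2,
    lintegral_enorm_pow_eq_ofReal (integrableOn_ball_of_continuous (by fun_prop)),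
    ← ofReal_norm, ← ENNReal.ofReal_pow (norm_nonneg _), ← ENNReal.ofReal_mul (sq_nonneg _),
    ENNReal.ofReal_le_ofReal_iff (integral_nonneg fun _ => sq_nonneg _)] at h
  have h2 := (mul_le_mul_of_nonneg_left hpow (sq_nonneg ‖c‖)).trans h
  refine le_of_sq_le_sq ?_ (mul_nonneg A2Norm_nonneg (by positivity))
  rw [mul_pow, sq_A2Norm zero_le_one, ← pow_mul, mul_comm k, pow_mul √((n : ℝ) + 1), Real.sq_sqrt (by positivity),
    one_pow, mul_one, ← one_div_div, ← volume_real_unitBall hn, one_div_mul_eq_div,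
    div_mul_eq_mul_div, le_div_iff₀ hvol]
  rw [← mul_div_assoc, div_le_iff₀ (by positivity)] at h2
  exact h2

theorem norm_fderiv_zero_apply_le (hn : n ≠ 0) (hF : DifferentiableOn ℂ F (ball 0 1))
    (hF2 : IntegrableOn (fun w => ‖F w‖ ^ 2) (ball 0 1)) {u : En n} (hu : ‖u‖ = 1) :
    ‖fderiv ℂ F 0 u‖ ≤ A2Norm 0 1 F * √(n + 1) := by
  have h := norm_taylorCoeff_le hn hF hF2 hu 1
  simpa [deriv_comp_smul_zero hF] using h

theorem norm_sub_sub_fderiv_zero_le (hn : n ≠ 0) (hF : DifferentiableOn ℂ F (ball 0 1))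
    (hF2 : IntegrableOn (fun w => ‖F w‖ ^ 2) (ball 0 1)) {w : En n} (hw : √(n + 1) * ‖w‖ < 1) :
    ‖F w - F 0 - fderiv ℂ F 0 w‖ ≤
      A2Norm 0 1 F * ((√(n + 1) * ‖w‖) ^ 2 / (1 - √(n + 1) * ‖w‖)) := by
  rcases eq_or_ne w 0 with rfl | hw0
  · simp
  have hwn : ‖w‖ ≠ 0 := norm_ne_zero_iff.2 hw0
  set y := √(n + 1) * ‖w‖ with hy
  set u : En n := (‖w‖ : ℂ)⁻¹ • w with hu_def
  have hu : ‖u‖ = 1 := by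
    rw [hu_def, norm_smul, norm_inv, Complex.norm_real, norm_norm, inv_mul_cancel₀ hwn]
  have hwu : (‖w‖ : ℂ) • u = w := smul_inv_smul₀ (by exact_mod_cast hwn) w
  have hN : 1 ≤ √((n : ℝ) + 1) := Real.one_le_sqrt.2 (by simp)
  have hw1 : ‖w‖ < 1 := by nlinarith [norm_nonneg w]
  have hs := Complex.hasSum_taylorSeries_on_ball (differentiableOn_comp_smul hF hu)
    (z := (‖w‖ : ℂ)) (by simpa using hw1)
  rw [← hasSum_nat_add_iff' 2] at hs
  simp only [Finset.sum_range_succ, Finset.sum_range_zero, sub_zero, hwu, Nat.factorial_zero,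
    Nat.factorial_one, Nat.cast_one, inv_one, one_smul, pow_zero, pow_one, iteratedDeriv_zero,
    iteratedDeriv_one, zero_smul, zero_add, deriv_comp_smul_zero hF] at hs
  rw [← map_smul, hwu, ← sub_sub] at hs
  have hy0 : 0 ≤ y := by positivity
  have hg : HasSum (fun k => A2Norm 0 1 F * y ^ 2 * y ^ k) (A2Norm 0 1 F * y ^ 2 * (1 - y)⁻¹) :=
    (hasSum_geometric_of_lt_one hy0 hw).mul_left _
  refine (hs.norm_le_of_bounded hg fun k => ?_).trans (le_of_eq ?_)
  · rw [smul_comm, norm_smul, norm_pow, Complex.norm_real, norm_norm]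
    refine (mul_le_mul_of_nonneg_left (norm_taylorCoeff_le hn hF hF2 hu (k + 2))
      (by positivity)).trans (le_of_eq ?_)
    rw [hy]
    ring
  · rw [div_eq_mul_inv, mul_assoc]

end UnitBallEstimates

section ChangeOfVariables

variable {n : ℕ}

theorem abs_det_restrictScalars (T : En n →L[ℂ] En n) :
    |(T.restrictScalars ℝ).det| = ‖LinearMap.det (T : En n →ₗ[ℂ] En n)‖ ^ 2 := by
  have h : (T.restrictScalars ℝ).det = Algebra.norm ℝ (LinearMap.det (T : En n →ₗ[ℂ] En n)) :=
    LinearMap.det_restrictScalars (R := ℝ) (f := (T : En n →ₗ[ℂ] En n))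
  rw [h, Algebra.norm_complex_apply, Complex.normSq_eq_norm_sq, abs_of_nonneg (sq_nonneg _)]

variable {a : En n}

theorem det_ballShrink (ha : ‖a‖ < 1) :
    LinearMap.det (ballShrink a : En n →ₗ[ℂ] En n) = (ballScale a : ℂ) ^ (n + 1) := by
  have hs := one_add_ballScale_ne_zero a
  have h : (ballShrink a : En n →ₗ[ℂ] En n) = (ballScale a : ℂ) •
      LinearMap.transvection (innerSL ℂ a : En n →ₗ[ℂ] ℂ)
        (-(1 + ballScale a : ℂ)⁻¹ • a) := by
    ext1 w
    simp [ballShrink_apply, LinearMap.transvection]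
    module
  rw [h, LinearMap.det_smul, LinearMap.transvection.det]
  simp only [ContinuousLinearMap.coe_coe, innerSL_apply_apply, inner_smul_right,
    inner_self_eq_one_sub_sq_ballScale ha, finrank_euclideanSpace, Fintype.card_fin]
  field_simp
  ring

/-- The complex derivative of `w ↦ ω + R • ballMap a w`. -/
def ballMapFDeriv (R : ℝ) (a w : En n) : En n →L[ℂ] En n :=
  ((R : ℂ) * (1 + ⟪a, w⟫_ℂ)⁻¹) • (ballShrink a).comp
    (ContinuousLinearMap.id ℂ (En n) - (1 + ⟪a, w⟫_ℂ)⁻¹ • (innerSL ℂ a).smulRight w)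

theorem hasFDerivAt_ballMap (ω : En n) (R : ℝ) {w : En n} (hw : 1 + ⟪a, w⟫_ℂ ≠ 0) :
    HasFDerivAt (fun w => ω + (R : ℂ) • ballMap a w) (ballMapFDeriv R a w) w := by
  have h1 : HasFDerivAt (fun w : En n => 1 + ⟪a, w⟫_ℂ) (innerSL ℂ a) w :=
    ((innerSL ℂ a).hasFDerivAt).const_add 1
  have h2 := (((hasDerivAt_inv hw).comp_hasFDerivAt w h1).smul
    (ballShrink a).hasFDerivAt (x := w)).const_add a
  refine ((h2.const_smul (R : ℂ)).const_add ω).congr_fderiv ?_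
  ext1 v
  simp [ballMapFDeriv]
  generalize 1 + ⟪a, w⟫_ℂ = c
  module

theorem det_ballMapFDeriv (ha : ‖a‖ < 1) (R : ℝ) {w : En n} (hw : 1 + ⟪a, w⟫_ℂ ≠ 0) :
    LinearMap.det (ballMapFDeriv R a w : En n →ₗ[ℂ] En n) =
      (R : ℂ) ^ n * (ballScale a : ℂ) ^ (n + 1) * ((1 + ⟪a, w⟫_ℂ)⁻¹) ^ (n + 1) := by
  have h : (ballMapFDeriv R a w : En n →ₗ[ℂ] En n) = ((R : ℂ) * (1 + ⟪a, w⟫_ℂ)⁻¹) •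
      (ballShrink a : En n →ₗ[ℂ] En n).comp (LinearMap.transvection (innerSL ℂ a : En n →ₗ[ℂ] ℂ)
        (-(1 + ⟪a, w⟫_ℂ)⁻¹ • w)) := by
    ext1 v
    simp [ballMapFDeriv, LinearMap.transvection]
    module
  rw [h, LinearMap.det_smul, LinearMap.det_comp, LinearMap.transvection.det, det_ballShrink ha]
  simp only [ContinuousLinearMap.coe_coe, innerSL_apply_apply, inner_smul_right,
    finrank_euclideanSpace, Fintype.card_fin]
  generalize hc : 1 + ⟪a, w⟫_ℂ = c at hw ⊢
  rw [show ⟪a, w⟫_ℂ = c - 1 by rw [← hc, add_sub_cancel_left],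
    show 1 + -c⁻¹ * (c - 1) = c⁻¹ by field_simp; ring]
  ring

theorem image_ballMap (ha : ‖a‖ < 1) (ω : En n) {R : ℝ} (hR : 0 < R) :
    (fun w => ω + (R : ℂ) • ballMap a w) '' ball 0 1 = ball ω R := by
  have hR' : (R : ℂ) ≠ 0 := by exact_mod_cast hR.ne'
  have hRn : ‖(R : ℂ)‖ = R := by rw [Complex.norm_real, Real.norm_of_nonneg hR.le]
  ext z
  constructor
  · rintro ⟨w, hw, rfl⟩
    rw [mem_ball_iff_norm, add_sub_cancel_left, norm_smul, hRn]
    exact mul_lt_of_lt_one_right hR (norm_ballMap_lt_one ha (mem_ball_zero_iff.1 hw))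
  · intro hz
    have hz1 : ‖(R : ℂ)⁻¹ • (z - ω)‖ < 1 := by
      rw [norm_smul, norm_inv, hRn, inv_mul_lt_one₀ hR]
      exact mem_ball_iff_norm.1 hz
    refine ⟨ballInv a ((R : ℂ)⁻¹ • (z - ω)), mem_ball_zero_iff.2 (norm_ballInv_lt_one ha hz1), ?_⟩
    simp only
    rw [ballMap_ballInv ha (one_sub_ne_zero_of_norm_lt_one (norm_inner_lt_one ha hz1)),
      smul_inv_smul₀ hR', add_sub_cancel]

theorem injOn_ballMap (ha : ‖a‖ < 1) (ω : En n) {R : ℝ} (hR : 0 < R) :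
    Set.InjOn (fun w => ω + (R : ℂ) • ballMap a w) (ball 0 1) := by
  have hR' : (R : ℂ) ≠ 0 := by exact_mod_cast hR.ne'
  intro w hw v hv h
  have hwv : ballMap a w = ballMap a v := smul_right_injective _ hR' (add_left_cancel h)
  have hne : ∀ w ∈ ball (0 : En n) 1, 1 + ⟪a, w⟫_ℂ ≠ 0 := fun w hw =>
    one_add_ne_zero_of_norm_lt_one (norm_inner_lt_one ha (mem_ball_zero_iff.1 hw))
  rw [← ballInv_ballMap ha (hne w hw), hwv, ballInv_ballMap ha (hne v hv)]

variable {G : Type*} [NormedAddCommGroup G] [NormedSpace ℂ G]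

/-- The isometric pull-back, up to a constant, of `A²(ω,R)` to `A²(0,1)` along
`w ↦ ω + R • ballMap a w`. -/
def ballPullback (ω : En n) (R : ℝ) (a : En n) (f : En n → G) (w : En n) : G :=
  ((1 + ⟪a, w⟫_ℂ)⁻¹) ^ (n + 1) • f (ω + (R : ℂ) • ballMap a w)

variable {f : En n → G} {ω : En n} {R : ℝ}

theorem abs_det_ballMapFDeriv_mul_norm_sq (ha : ‖a‖ < 1) {w : En n} (hw : w ∈ ball (0 : En n) 1) :
    |((ballMapFDeriv R a w).restrictScalars ℝ).det| • ‖f (ω + (R : ℂ) • ballMap a w)‖ ^ 2 =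
      (R ^ (2 * n) * (ballScale a ^ (n + 1)) ^ 2) * ‖ballPullback ω R a f w‖ ^ 2 := by
  have hne : 1 + ⟪a, w⟫_ℂ ≠ 0 :=
    one_add_ne_zero_of_norm_lt_one (norm_inner_lt_one ha (mem_ball_zero_iff.1 hw))
  rw [abs_det_restrictScalars, det_ballMapFDeriv ha R hne, ballPullback, norm_smul, smul_eq_mul,
    norm_mul, norm_mul, norm_pow (ballScale a : ℂ), Complex.norm_real,
    Real.norm_of_nonneg (ballScale_nonneg a), norm_pow (R : ℂ), Complex.norm_real, pow_mul,
    ← sq_abs R, Real.norm_eq_abs]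
  ring

theorem integrableOn_norm_sq_ballPullback (ha : ‖a‖ < 1) (hR : 0 < R)
    (hf : IntegrableOn (fun z => ‖f z‖ ^ 2) (ball ω R)) :
    IntegrableOn (fun w => ‖ballPullback ω R a f w‖ ^ 2) (ball 0 1) := by
  have hs := ballScale_pos ha
  rw [← image_ballMap ha ω hR, integrableOn_image_iff_integrableOn_abs_det_fderiv_smul _
    measurableSet_ball (fun w hw => ((hasFDerivAt_ballMap ω R (one_add_ne_zero_of_norm_lt_one
      (norm_inner_lt_one ha (mem_ball_zero_iff.1 hw)))).restrictScalars ℝ).hasFDerivWithinAt)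
    (injOn_ballMap ha ω hR), integrableOn_congr_fun
      (fun w hw => abs_det_ballMapFDeriv_mul_norm_sq ha hw) measurableSet_ball] at hf
  refine (integrable_const_mul_iff (IsUnit.mk0 _ ?_) _).1 hf
  positivity

theorem A2Norm_ballPullback (ha : ‖a‖ < 1) (hR : 0 < R) :
    A2Norm ω R f = ballScale a ^ (n + 1) * A2Norm 0 1 (ballPullback ω R a f) := by
  have hs := ballScale_pos ha
  have h := integral_image_eq_integral_abs_det_fderiv_smul (volume : Measure (En n))
    measurableSet_ball (fun w hw => ((hasFDerivAt_ballMap ω R (one_add_ne_zero_of_norm_lt_one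
      (norm_inner_lt_one ha (mem_ball_zero_iff.1 hw)))).restrictScalars ℝ).hasFDerivWithinAt)
    (injOn_ballMap ha ω hR) fun z => ‖f z‖ ^ 2
  rw [image_ballMap ha ω hR, setIntegral_congr_fun measurableSet_ball
    (fun w hw => abs_det_ballMapFDeriv_mul_norm_sq ha hw), integral_const_mul] at h
  refine (sq_eq_sq₀ A2Norm_nonneg (mul_nonneg (by positivity) A2Norm_nonneg)).1 ?_
  rw [mul_pow, sq_A2Norm zero_le_one, sq_A2Norm hR.le, h]
  field_simp
  ring

theorem differentiableOn_ballPullback (ha : ‖a‖ < 1) (hR : 0 < R)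
    (hf : DifferentiableOn ℂ f (ball ω R)) :
    DifferentiableOn ℂ (ballPullback ω R a f) (ball 0 1) := by
  have h : DifferentiableOn ℂ (fun w : En n => 1 + ⟪a, w⟫_ℂ) (ball 0 1) :=
    ((innerSL ℂ a).differentiable.const_add 1).differentiableOn
  refine ((h.inv fun w hw => one_add_ne_zero_of_norm_lt_one
    (norm_inner_lt_one ha (mem_ball_zero_iff.1 hw))).pow (n + 1)).smul
    (hf.comp (((differentiableOn_ballMap ha).const_smul (R : ℂ)).const_add ω) ?_)
  rw [← image_ballMap ha ω hR]
  exact Set.mapsTo_image _ _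

theorem fderiv_ballPullback_zero (ha : ‖a‖ < 1) (hR : 0 < R)
    (hf : DifferentiableOn ℂ f (ball ω R)) (v : En n) :
    fderiv ℂ (ballPullback ω R a f) 0 v =
      fderiv ℂ f (ω + (R : ℂ) • a) ((R : ℂ) • ballShrink a v) -
        ((n + 1 : ℂ) * ⟪a, v⟫_ℂ) • f (ω + (R : ℂ) • a) := by
  have hx : ω + (R : ℂ) • a ∈ ball ω R := by
    rw [← image_ballMap ha ω hR]
    exact ⟨0, mem_ball_self one_pos, by simp [ballMap_zero]⟩
  have hne : 1 + ⟪a, (0 : En n)⟫_ℂ ≠ 0 := by simp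
  have h1 : HasFDerivAt (fun w : En n => 1 + ⟪a, w⟫_ℂ) (innerSL ℂ a) 0 :=
    ((innerSL ℂ a).hasFDerivAt).const_add 1
  have h2 : HasFDerivAt f (fderiv ℂ f (ω + (R : ℂ) • a)) (ω + (R : ℂ) • ballMap a 0) := by
    rw [ballMap_zero]
    exact (hf.differentiableAt (isOpen_ball.mem_nhds hx)).hasFDerivAt
  have h3 := (((hasDerivAt_inv hne).comp_hasFDerivAt 0 h1).pow (n + 1)).smul
    (h2.comp 0 (hasFDerivAt_ballMap ω R hne))
  have h4 : fderiv ℂ (ballPullback ω R a f) 0 = _ := h3.fderiv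
  rw [h4]
  simp [ballMapFDeriv, ballMap_zero]
  module

end ChangeOfVariables

section Majorant

theorem three_le_sq_of_le {ν γ : ℝ} (hγ : 0 ≤ γ)
    (h : 3 ≤ γ ^ 2 * (1 - ν ^ 2)) : 3 ≤ γ ^ 2 ∧ 8 / 3 * ν ≤ γ := by
  have hg : 3 ≤ γ ^ 2 := by linarith [mul_nonneg (sq_nonneg γ) (sq_nonneg ν)]
  refine ⟨hg, le_of_sq_le_sq ?_ hγ⟩
  have h3 : 0 < 1 - ν ^ 2 := (mul_pos_iff_of_pos_left (by linarith : 0 < γ ^ 2)).1 (by linarith)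
  refine le_of_mul_le_mul_right (le_trans ?_ h) h3
  nlinarith [sq_nonneg (ν ^ 2 - 1 / 2)]

theorem majorant_pos_at_inv {ν γ α : ℝ} (h1 : ν ≤ 1) (hγ : 1 ≤ γ) (hα0 : 0 ≤ α)
    (hγ3 : 3 ≤ γ ^ 2) (hα : α * (4 * γ + 1) ≤ 1) :
    0 < 1 / (γ + 1) - α - 4 / 3 * ν * α * (1 / (γ + 1)) - γ * (1 / (γ + 1)) ^ 2 / 2 := by
  have hg : 0 < γ + 1 := by linarith
  have e2 : 8 / 3 * ν * α * (γ + 1) ≤ 8 / 3 * 1 * α * (γ + 1) := by gcongr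
  have e3 : 0 < (γ + 2) * (4 * γ + 1) - 2 * ((γ + 1) * (γ + 7 / 3)) := by linarith
  have e4 : (γ + 2) * (α * (4 * γ + 1)) ≤ (γ + 2) * 1 :=
    mul_le_mul_of_nonneg_left hα (by linarith)
  have e5 : 0 < 2 * (γ + 1) - 2 * α * (γ + 1) ^ 2 - 8 / 3 * ν * α * (γ + 1) - γ := by
    rcases eq_or_lt_of_le hα0 with h | h
    · rw [← h]
      linarith
    · have := mul_pos h e3
      linarith
  have e6 : 1 / (γ + 1) - α - 4 / 3 * ν * α * (1 / (γ + 1)) - γ * (1 / (γ + 1)) ^ 2 / 2 =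
      (1 / (γ + 1)) ^ 2 / 2 *
        (2 * (γ + 1) - 2 * α * (γ + 1) ^ 2 - 8 / 3 * ν * α * (γ + 1) - γ) := by
    field_simp
    ring
  rw [e6]
  positivity

/-- Beyond the first root of the majorant polynomial `(γ + 1) t ^ 2 - (α + 1) t + α`, the Newton
operator contracts the ball of radius `t` strictly into itself. -/
theorem majorant_lt {ν γ α T : ℝ} (h0 : 0 ≤ ν) (h1 : ν < 1) (hγ : 1 ≤ γ) (hα0 : 0 ≤ α)
    (hν : 3 ≤ γ ^ 2 * (1 - ν ^ 2))
    (hα : α < 2 * γ + 1 - √((2 * γ + 1) ^ 2 - 1))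
    (hT : (α + 1 - √((α + 1) ^ 2 - 4 * α * (γ + 1))) / (2 * (γ + 1)) < T)
    (hT' : T < 1 / (γ + 1)) :
    α + 4 / 3 * ν * α * T + γ * T ^ 2 / 2 < T := by
  obtain ⟨hg3, hγν⟩ := three_le_sq_of_le (by linarith) hν
  have hg : 0 < γ + 1 := by linarith
  set r := √((2 * γ + 1) ^ 2 - 1) with hr
  have hr0 : 0 ≤ r := Real.sqrt_nonneg _
  have hr2 : r ^ 2 = (2 * γ + 1) ^ 2 - 1 := Real.sq_sqrt (by nlinarith)
  have hrγ : 2 * γ ≤ r := Real.le_sqrt_of_sq_le (by nlinarith)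
  have hα4 : α * (4 * γ + 1) ≤ 1 := by
    have := mul_nonneg (sub_nonneg.2 hα.le) (by linarith : 0 ≤ 2 * γ + 1 + r)
    have := mul_le_mul_of_nonneg_left hrγ hα0
    linarith
  have hdisc : 0 ≤ (α + 1) ^ 2 - 4 * α * (γ + 1) := by
    linarith [mul_nonneg (by linarith : 0 ≤ 2 * γ + 1 - α - r) (by linarith : 0 ≤ 2 * γ + 1 - α + r)]
  set D := √((α + 1) ^ 2 - 4 * α * (γ + 1)) with hD
  have hD0 : 0 ≤ D := Real.sqrt_nonneg _
  have hD2 : D ^ 2 = (α + 1) ^ 2 - 4 * α * (γ + 1) := Real.sq_sqrt hdisc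
  have hD1 : D ≤ α + 1 := by
    refine le_of_sq_le_sq ?_ (by linarith)
    rw [hD2]
    linarith [mul_nonneg hα0 hg.le]
  set t := (α + 1 - D) / (2 * (γ + 1)) with ht
  have ht0 : 0 ≤ t := div_nonneg (by linarith) (by linarith)
  have htroot : (γ + 1) * t ^ 2 - (α + 1) * t + α = 0 := by
    have : D = α + 1 - 2 * (γ + 1) * t := by
      rw [ht]
      field_simp
      ring
    rw [this] at hD2
    nlinarith
  have hS := hT.trans hT'
  set S := 1 / (γ + 1) with hSdef
  have hS1 : (γ + 1) * S = 1 := by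
    rw [hSdef]
    field_simp
  have htS : (γ + 1) * t < 1 := (mul_lt_mul_of_pos_left hS hg).trans_eq hS1
  have ht1 : t < 1 / 2 := by nlinarith
  have hαγ : α * (1 - t) = t - t ^ 2 - γ * t ^ 2 := by linear_combination htroot
  have hαt : α ≤ t := by
    refine le_of_mul_le_mul_right ?_ (by linarith : 0 < 1 - t)
    rw [hαγ]
    linarith [mul_nonneg (by linarith : 0 ≤ γ) (sq_nonneg t)]
  have hQt : 0 ≤ t - α - 4 / 3 * ν * α * t - γ * t ^ 2 / 2 := by
    have e1 : γ * t ^ 2 ≤ t - α := by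
      have : 0 ≤ t * (t - α) := mul_nonneg ht0 (by linarith)
      linarith
    have e2 : 4 / 3 * ν * α * t ≤ 4 / 3 * ν * t * t := by gcongr
    have e3 : 4 / 3 * ν * t * t ≤ γ / 2 * t ^ 2 := by nlinarith [sq_nonneg t]
    linarith
  have hQS : 0 < S - α - 4 / 3 * ν * α * S - γ * S ^ 2 / 2 :=
    majorant_pos_at_inv h1.le hγ hα0 hg3 hα4
  have hconv : (T - α - 4 / 3 * ν * α * T - γ * T ^ 2 / 2) * (S - t) =
      (t - α - 4 / 3 * ν * α * t - γ * t ^ 2 / 2) * (S - T) +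
      (S - α - 4 / 3 * ν * α * S - γ * S ^ 2 / 2) * (T - t) +
      γ / 2 * ((T - t) * (S - T) * (S - t)) := by ring
  have p1 : 0 < S - T := by linarith
  have p2 : 0 < T - t := by linarith
  have p3 : 0 < S - t := by linarith
  have : 0 < (T - α - 4 / 3 * ν * α * T - γ * T ^ 2 / 2) * (S - t) := by
    rw [hconv]
    positivity
  have := (mul_pos_iff_of_pos_right p3).1 this
  linarith

/-- The bound on the Taylor remainder in terms of `t`, where `Q` stands for `|1 - q|`. -/
theorem remainder_le {N t γ Q y : ℝ} (hN : 3 ≤ N) (ht : 0 ≤ t) (hγ : 3 ≤ γ ^ 2) (hγ0 : 0 ≤ γ)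
    (htγ : t < 1 / (γ + 1)) (hQ : 1 - t / N ≤ Q) (hy0 : 0 ≤ y) (hy : y * Q ≤ t / √N) :
    y < 1 ∧ Q * (y ^ 2 / (1 - y)) ≤ t ^ 2 / 2 := by
  set M := √N with hM
  have hM0 : 0 ≤ M := Real.sqrt_nonneg _
  have hM2 : M ^ 2 = N := Real.sq_sqrt (by linarith)
  have hMpos : 0 < M := by nlinarith
  rw [lt_div_iff₀ (by linarith)] at htγ
  set w := √(3 : ℝ)
  have hw0 : 0 ≤ w := Real.sqrt_nonneg _
  have hw2 : w ^ 2 = 3 := Real.sq_sqrt (by norm_num)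
  have hwγ : w ≤ γ := Real.sqrt_le_iff.2 ⟨hγ0, hγ⟩
  have hwM : w ≤ M := Real.sqrt_le_sqrt hN
  have hw1 : 1 ≤ w := by nlinarith
  have ht1 : t * (w + 1) ≤ 1 := by nlinarith
  have ht' : t ≤ 1 := by nlinarith
  have hkey : 2 ≤ N - t - M * t := by nlinarith [mul_nonneg (sub_nonneg.2 hwM) (sub_nonneg.2 ht')]
  have hz : 0 ≤ t / M := by positivity
  have hz2 : (t / M) ^ 2 * N = t ^ 2 := by
    rw [← hM2]
    field_simp
  have hNpos : 0 < N := by linarith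
  have hdiff : 2 / N ≤ Q - t / M := by
    have : (N - t - M * t) / N = 1 - t / N - t / M := by
      rw [← hM2]
      field_simp
    have h2 : 2 / N ≤ (N - t - M * t) / N := by gcongr
    linarith
  have hQ0 : 0 < Q := by
    have : 0 < 2 / N := by positivity
    linarith
  have hy1 : y < 1 := by
    have : 0 < 2 / N := by positivity
    by_contra! h
    nlinarith
  refine ⟨hy1, ?_⟩
  have h1y : 0 < 1 - y := by linarith
  rw [← mul_div_assoc, div_le_iff₀ h1y]
  have e1 : (y * Q) ^ 2 ≤ (t / M) ^ 2 := pow_le_pow_left₀ (by positivity) hy 2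
  have e2 : 2 ≤ (Q - y * Q) * N := by
    rw [div_le_iff₀ hNpos] at hdiff
    nlinarith
  have e3 : (y * Q) ^ 2 * 2 ≤ (t / M) ^ 2 * ((Q - y * Q) * N) := by gcongr
  have e4 : (t / M) ^ 2 * ((Q - y * Q) * N) = t ^ 2 * ((1 - y) * Q) := by
    rw [← hz2]
    ring
  rw [e4] at e3
  refine le_of_mul_le_mul_right ?_ hQ0
  nlinarith

end Majorant

section AlphaTheorem

variable {n : ℕ} {a : En n} {R : ℝ}

/-- The displacement `h` measured along `a`, normalised so that `1 - ballSlope R a h` is the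
denominator of `ballInv a` at `a + h / R` divided by its value at `a`. -/
def ballSlope (R : ℝ) (a h : En n) : ℂ := ((R * ballScale a ^ 2 : ℝ) : ℂ)⁻¹ * ⟪a, h⟫_ℂ

theorem one_sub_inner_add_smul (ha : ‖a‖ < 1) (hR : 0 < R) (h : En n) :
    1 - ⟪a, a + (R : ℂ)⁻¹ • h⟫_ℂ = (ballScale a : ℂ) ^ 2 * (1 - ballSlope R a h) := by
  have hR' : (R : ℂ) ≠ 0 := by exact_mod_cast hR.ne'
  have hs : (ballScale a : ℂ) ≠ 0 := by exact_mod_cast (ballScale_pos ha).ne'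
  rw [inner_add_right, inner_smul_right, inner_self_eq_one_sub_sq_ballScale ha, ballSlope]
  push_cast
  field_simp
  ring

theorem ballInv_add_smul (ha : ‖a‖ < 1) (hR : 0 < R) (h : En n) :
    ballInv a (a + (R : ℂ)⁻¹ • h) =
      (((R * ballScale a ^ 2 : ℝ) : ℂ)⁻¹ * (1 - ballSlope R a h)⁻¹) • ballStretch a h := by
  rw [ballInv, one_sub_inner_add_smul ha hR, add_sub_cancel_left, map_smul, smul_smul]
  congr 1
  push_cast
  rw [mul_inv, mul_inv]
  ring

theorem one_sub_inner_add_smul_ne_zero (ha : ‖a‖ < 1) (hR : 0 < R) {h : En n}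
    (hq : 1 - ballSlope R a h ≠ 0) : 1 - ⟪a, a + (R : ℂ)⁻¹ • h⟫_ℂ ≠ 0 := by
  rw [one_sub_inner_add_smul ha hR]
  exact mul_ne_zero (pow_ne_zero 2 (by exact_mod_cast (ballScale_pos ha).ne')) hq

theorem one_add_inner_ballInv_add_smul (ha : ‖a‖ < 1) (hR : 0 < R) {h : En n}
    (hq : 1 - ballSlope R a h ≠ 0) :
    1 + ⟪a, ballInv a (a + (R : ℂ)⁻¹ • h)⟫_ℂ = (1 - ballSlope R a h)⁻¹ := by
  have hs : (ballScale a : ℂ) ≠ 0 := by exact_mod_cast (ballScale_pos ha).ne'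
  rw [one_add_inner_ballInv ha (one_sub_inner_add_smul_ne_zero ha hR hq),
    one_sub_inner_add_smul ha hR]
  field_simp

theorem smul_ballShrink_ballInv_add_smul (ha : ‖a‖ < 1) (hR : 0 < R) {h : En n} :
    (R : ℂ) • ballShrink a (ballInv a (a + (R : ℂ)⁻¹ • h)) = (1 - ballSlope R a h)⁻¹ • h := by
  have hR' : (R : ℂ) ≠ 0 := by exact_mod_cast hR.ne'
  have hs : (ballScale a : ℂ) ≠ 0 := by exact_mod_cast (ballScale_pos ha).ne'
  rw [ballInv_add_smul ha hR, map_smul, ballShrink_ballStretch ha, smul_smul, smul_smul]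
  congr 1
  push_cast
  field_simp

variable {ω : En n} {f : En n → En n}

theorem ballPullback_ballInv_add_smul (ha : ‖a‖ < 1) (hR : 0 < R) {h : En n}
    (hq : 1 - ballSlope R a h ≠ 0) :
    ballPullback ω R a f (ballInv a (a + (R : ℂ)⁻¹ • h)) =
      (1 - ballSlope R a h) ^ (n + 1) • f (ω + (R : ℂ) • a + h) := by
  have hR' : (R : ℂ) ≠ 0 := by exact_mod_cast hR.ne'
  rw [ballPullback, one_add_inner_ballInv_add_smul ha hR hq, inv_inv,
    ballMap_ballInv ha (one_sub_inner_add_smul_ne_zero ha hR hq), smul_add, smul_inv_smul₀ hR',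
    add_assoc]

/-- The map whose fixed points are the `h` with `f (ω + R a + h) = 0`. -/
def newtonMap (ω : En n) (R : ℝ) (a : En n) (f : En n → En n) (A : En n ≃L[ℂ] En n)
    (h : En n) : En n :=
  h - (1 - ballSlope R a h) ^ (n + 2) • A.symm (f (ω + (R : ℂ) • a + h))

variable {A : En n ≃L[ℂ] En n}

theorem newtonMap_eq (ha : ‖a‖ < 1) (hR : 0 < R) (hf : DifferentiableOn ℂ f (ball ω R))
    (hA : (A : En n →L[ℂ] En n) = fderiv ℂ f (ω + (R : ℂ) • a)) {h : En n}
    (hq : 1 - ballSlope R a h ≠ 0) :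
    newtonMap ω R a f A h =
      (((n : ℂ) + 2) * ballSlope R a h - 1) • A.symm (f (ω + (R : ℂ) • a)) -
        (1 - ballSlope R a h) • A.symm (ballPullback ω R a f (ballInv a (a + (R : ℂ)⁻¹ • h)) -
          ballPullback ω R a f 0 -
          fderiv ℂ (ballPullback ω R a f) 0 (ballInv a (a + (R : ℂ)⁻¹ • h))) := by
  have h0 : ballPullback ω R a f 0 = f (ω + (R : ℂ) • a) := by simp [ballPullback, ballMap_zero]
  have hW : ⟪a, ballInv a (a + (R : ℂ)⁻¹ • h)⟫_ℂ = (1 - ballSlope R a h)⁻¹ - 1 :=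
    eq_sub_of_add_eq' (one_add_inner_ballInv_add_smul ha hR hq)
  rw [h0, fderiv_ballPullback_zero ha hR hf, ballPullback_ballInv_add_smul ha hR hq,
    smul_ballShrink_ballInv_add_smul ha hR, hW, ← hA, newtonMap]
  simp only [map_sub, map_smul, ContinuousLinearEquiv.coe_coe,
    ContinuousLinearEquiv.symm_apply_apply]
  match_scalars
  · field_simp
  · field_simp
    ring
  · field_simp
    ring

theorem norm_ballSlope_le {κ : ℝ} (ha : ‖a‖ < 1) (hR : 0 < R)
    (hκ : (n + 1) / (R * ballScale a ^ 2) ≤ κ) (h : En n) :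
    ‖ballSlope R a h‖ ≤ ‖a‖ * (κ * ‖h‖ / (n + 1)) := by
  have hs := ballScale_pos ha
  have hRs : 0 < R * ballScale a ^ 2 := by positivity
  rw [div_le_iff₀ hRs] at hκ
  rw [ballSlope, norm_mul, norm_inv, Complex.norm_real, Real.norm_of_nonneg hRs.le,
    inv_mul_le_iff₀ hRs]
  refine (norm_inner_le_norm a h).trans ?_
  rw [mul_left_comm]
  refine mul_le_mul_of_nonneg_left ?_ (norm_nonneg a)
  rw [mul_div_assoc', le_div_iff₀ (by positivity)]
  nlinarith [norm_nonneg h]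

theorem one_sub_ballSlope_ne_zero {κ : ℝ} (ha : ‖a‖ < 1) (hR : 0 < R)
    (hκ : (n + 1) / (R * ballScale a ^ 2) ≤ κ) {h : En n} (hh : κ * ‖h‖ < 1) :
    1 - ballSlope R a h ≠ 0 := by
  have h1 := norm_ballSlope_le ha hR hκ h
  have h2 : κ * ‖h‖ / ((n : ℝ) + 1) < 1 := by
    rw [div_lt_one (by positivity)]
    linarith [(Nat.cast_nonneg n : (0 : ℝ) ≤ n)]
  refine one_sub_ne_zero_of_norm_lt_one ?_
  nlinarith [norm_nonneg a]

theorem norm_ballInv_add_smul_mul_le {κ : ℝ} (ha : ‖a‖ < 1) (hR : 0 < R)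
    (hκ : (n + 1) / (R * ballScale a ^ 2) ≤ κ) {h : En n} (hq : 1 - ballSlope R a h ≠ 0) :
    ‖ballInv a (a + (R : ℂ)⁻¹ • h)‖ * ‖1 - ballSlope R a h‖ ≤ κ * ‖h‖ / (n + 1) := by
  have hs := ballScale_pos ha
  have hRs : 0 < R * ballScale a ^ 2 := by positivity
  have hq' : 0 < ‖1 - ballSlope R a h‖ := norm_pos_iff.2 hq
  rw [div_le_iff₀ hRs] at hκ
  rw [ballInv_add_smul ha hR, norm_smul, norm_mul, norm_inv, norm_inv, Complex.norm_real,
    Real.norm_of_nonneg hRs.le, mul_right_comm, inv_mul_cancel_right₀ hq'.ne',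
    inv_mul_le_iff₀ hRs]
  refine (norm_ballStretch_le ha h).trans ?_
  rw [mul_div_assoc', le_div_iff₀ (by positivity)]
  nlinarith [norm_nonneg h]

theorem norm_newtonMap_le {κ γ : ℝ} (hn : 2 ≤ n) (ha : ‖a‖ < 1) (hR : 0 < R)
    (hf : DifferentiableOn ℂ f (ball ω R))
    (hf2 : IntegrableOn (fun z => ‖f z‖ ^ 2) (ball ω R))
    (hA : (A : En n →L[ℂ] En n) = fderiv ℂ f (ω + (R : ℂ) • a)) (hκ0 : 0 ≤ κ)
    (hκ : (n + 1) / (R * ballScale a ^ 2) ≤ κ) (hγ0 : 0 ≤ γ) (hγ3 : 3 ≤ γ ^ 2)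
    (hγ : A2Norm 0 1 (ballPullback ω R a f) * κ * ‖(A.symm : En n →L[ℂ] En n)‖ ≤ γ)
    {h : En n} (hh : κ * ‖h‖ < 1 / (γ + 1)) :
    κ * ‖newtonMap ω R a f A h‖ ≤ ‖A.symm (f (ω + (R : ℂ) • a))‖ * κ +
      4 / 3 * ‖a‖ * (‖A.symm (f (ω + (R : ℂ) • a))‖ * κ) * (κ * ‖h‖) +
        γ * (κ * ‖h‖) ^ 2 / 2 := by
  set t := κ * ‖h‖ with ht
  set q := ballSlope R a h with hq_def
  set W := ballInv a (a + (R : ℂ)⁻¹ • h) with hW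
  set e := A.symm (f (ω + (R : ℂ) • a)) with he
  have ht0 : 0 ≤ t := by positivity
  have hN : (3 : ℝ) ≤ n + 1 := by
    have : (2 : ℝ) ≤ n := by exact_mod_cast hn
    linarith
  have hqν : ‖q‖ ≤ ‖a‖ * (t / (n + 1)) := norm_ballSlope_le ha hR hκ h
  have htN : 0 ≤ t / ((n : ℝ) + 1) := by positivity
  have hqt : ‖q‖ ≤ t / (n + 1) := hqν.trans (by nlinarith)
  have hQ : 1 - t / (n + 1) ≤ ‖1 - q‖ := by
    have := norm_sub_norm_le (1 : ℂ) q
    rw [norm_one] at this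
    linarith
  have ht1 : t < 1 := hh.trans_le (by rw [div_le_one (by linarith)]; linarith)
  have hq : 1 - q ≠ 0 := one_sub_ballSlope_ne_zero ha hR hκ ht1
  have hM : 0 < √((n : ℝ) + 1) := Real.sqrt_pos.2 (by linarith)
  have hy : √((n : ℝ) + 1) * ‖W‖ * ‖1 - q‖ ≤ t / √((n : ℝ) + 1) := by
    have := norm_ballInv_add_smul_mul_le ha hR hκ hq
    rw [mul_assoc]
    refine (mul_le_mul_of_nonneg_left this hM.le).trans_eq ?_
    rw [← ht]
    nth_rw 2 [← Real.sq_sqrt (show (0 : ℝ) ≤ n + 1 by linarith)]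
    field_simp
  obtain ⟨hy1, hrem⟩ := remainder_le hN ht0 hγ3 hγ0 hh hQ (by positivity) hy
  have hP := norm_sub_sub_fderiv_zero_le (F := ballPullback ω R a f) (by lia)
    (differentiableOn_ballPullback ha hR hf) (integrableOn_norm_sq_ballPullback ha hR hf2) hy1
  rw [newtonMap_eq ha hR hf hA hq]
  set D := ballPullback ω R a f W - ballPullback ω R a f 0 -
    fderiv ℂ (ballPullback ω R a f) 0 W with hD
  set y := √((n : ℝ) + 1) * ‖W‖ with hy_def
  have h1 : ‖((n : ℂ) + 2) * q - 1‖ ≤ 1 + 4 / 3 * ‖a‖ * t := by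
    have h2 : ‖((n : ℂ) + 2) * q - 1‖ ≤ ((n : ℝ) + 2) * ‖q‖ + 1 := by
      refine (norm_sub_le _ _).trans_eq ?_
      rw [norm_mul, norm_one]
      congr 2
      exact_mod_cast Complex.norm_natCast (n + 2)
    have h3 : ((n : ℝ) + 2) * (t / (n + 1)) ≤ 4 / 3 * t := by
      rw [mul_div_assoc', div_le_iff₀ (by linarith)]
      nlinarith
    nlinarith [norm_nonneg a, norm_nonneg q]
  have h2 : κ * (‖1 - q‖ * ‖A.symm D‖) ≤ γ * t ^ 2 / 2 := by
    have h3 : ‖A.symm D‖ ≤ ‖(A.symm : En n →L[ℂ] En n)‖ * ‖D‖ :=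
      (A.symm : En n →L[ℂ] En n).le_opNorm D
    calc κ * (‖1 - q‖ * ‖A.symm D‖)
        ≤ κ * (‖1 - q‖ * (‖(A.symm : En n →L[ℂ] En n)‖ *
            (A2Norm 0 1 (ballPullback ω R a f) * (y ^ 2 / (1 - y))))) := by
          gcongr
          exact h3.trans (by gcongr)
      _ = (A2Norm 0 1 (ballPullback ω R a f) * κ * ‖(A.symm : En n →L[ℂ] En n)‖) *
            (‖1 - q‖ * (y ^ 2 / (1 - y))) := by ring
      _ ≤ γ * (t ^ 2 / 2) := by
          have : 0 < 1 - y := by linarith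
          gcongr
      _ = γ * t ^ 2 / 2 := by ring
  calc κ * ‖(((n : ℂ) + 2) * q - 1) • e - (1 - q) • A.symm D‖
      ≤ κ * (‖((n : ℂ) + 2) * q - 1‖ * ‖e‖ + ‖1 - q‖ * ‖A.symm D‖) := by
        gcongr
        refine (norm_sub_le _ _).trans_eq ?_
        rw [norm_smul, norm_smul]
    _ ≤ κ * ((1 + 4 / 3 * ‖a‖ * t) * ‖e‖) + γ * t ^ 2 / 2 := by
        rw [mul_add]
        gcongr
    _ = _ := by ring

theorem exists_unit_orthogonal (hn : 2 ≤ n) (a : En n) : ∃ u : En n, ‖u‖ = 1 ∧ ⟪a, u⟫_ℂ = 0 := by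
  have hne : (ℂ ∙ a)ᗮ ≠ ⊥ := by
    intro h
    have h1 := Submodule.finrank_add_finrank_orthogonal (𝕜 := ℂ) (ℂ ∙ a)
    have h2 := finrank_span_le_card (R := ℂ) ({a} : Set (En n))
    rw [Set.toFinset_singleton, Finset.card_singleton] at h2
    rw [h, finrank_bot, finrank_euclideanSpace_fin] at h1
    lia
  obtain ⟨v, hv, hv0⟩ := Submodule.exists_mem_ne_zero_of_ne_bot hne
  refine ⟨((‖v‖ : ℂ)⁻¹) • v, ?_, ?_⟩
  · exact norm_smul_inv_norm hv0
  · rw [inner_smul_right, Submodule.mem_orthogonal_singleton_iff_inner_right.1 hv, mul_zero]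

theorem mul_ballScale_le (hn : 2 ≤ n) (ha : ‖a‖ < 1) (hR : 0 < R)
    (hf : DifferentiableOn ℂ f (ball ω R))
    (hf2 : IntegrableOn (fun z => ‖f z‖ ^ 2) (ball ω R))
    (hA : (A : En n →L[ℂ] En n) = fderiv ℂ f (ω + (R : ℂ) • a)) :
    R * ballScale a ≤ A2Norm 0 1 (ballPullback ω R a f) * √(n + 1) *
      ‖(A.symm : En n →L[ℂ] En n)‖ := by
  obtain ⟨u, hu, hau⟩ := exists_unit_orthogonal hn a
  have hP := norm_fderiv_zero_apply_le (F := ballPullback ω R a f) (by lia)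
    (differentiableOn_ballPullback ha hR hf) (integrableOn_norm_sq_ballPullback ha hR hf2) hu
  rw [fderiv_ballPullback_zero ha hR hf, hau, mul_zero, zero_smul, sub_zero, ← hA,
    ballShrink_apply, hau, zero_smul, smul_zero, sub_zero, ContinuousLinearEquiv.coe_coe] at hP
  have h1 : ‖(R : ℂ) • (ballScale a : ℂ) • u‖ = R * ballScale a := by
    rw [norm_smul, norm_smul, hu, Complex.norm_real, Complex.norm_real, Real.norm_of_nonneg hR.le,
      Real.norm_of_nonneg (ballScale_nonneg a), mul_one]
  have h2 := (A.symm : En n →L[ℂ] En n).le_opNorm (A ((R : ℂ) • (ballScale a : ℂ) • u))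
  rw [ContinuousLinearEquiv.coe_coe, A.symm_apply_apply, h1] at h2
  rw [mul_comm _ ‖(A.symm : En n →L[ℂ] En n)‖]
  exact h2.trans (by gcongr)

theorem three_le_sq_mul {κ γ : ℝ} (hn : 2 ≤ n) (ha : ‖a‖ < 1) (hR : 0 < R)
    (hf : DifferentiableOn ℂ f (ball ω R))
    (hf2 : IntegrableOn (fun z => ‖f z‖ ^ 2) (ball ω R))
    (hA : (A : En n →L[ℂ] En n) = fderiv ℂ f (ω + (R : ℂ) • a))
    (hκ : (n + 1) / (R * ballScale a ^ 2) ≤ κ)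
    (hγ : A2Norm 0 1 (ballPullback ω R a f) * κ * ‖(A.symm : En n →L[ℂ] En n)‖ ≤ γ) :
    3 ≤ γ ^ 2 * (1 - ‖a‖ ^ 2) := by
  have hs := ballScale_pos ha
  have h1 := mul_ballScale_le hn ha hR hf hf2 hA
  have hN : (3 : ℝ) ≤ n + 1 := by
    have : (2 : ℝ) ≤ n := by exact_mod_cast hn
    linarith
  have hM : 0 < √((n : ℝ) + 1) := Real.sqrt_pos.2 (by linarith)
  have hM2 : √((n : ℝ) + 1) ^ 2 = n + 1 := Real.sq_sqrt (by linarith)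
  set M := √((n : ℝ) + 1)
  set X := A2Norm 0 1 (ballPullback ω R a f) * ‖(A.symm : En n →L[ℂ] En n)‖ with hX
  have hX0 : 0 ≤ X := mul_nonneg (Real.sqrt_nonneg _) (norm_nonneg _)
  have h2 : M ^ 2 / (R * ballScale a ^ 2) * X ≤ γ := by
    rw [hM2]
    refine le_trans (mul_le_mul_of_nonneg_right hκ hX0) (le_trans (le_of_eq ?_) hγ)
    rw [hX]
    ring
  have h3 : M ≤ γ * ballScale a := by
    rw [div_mul_eq_mul_div, div_le_iff₀ (by positivity)] at h2
    have h4 : M * (R * ballScale a) ≤ γ * ballScale a * (R * ballScale a) :=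
      calc M * (R * ballScale a) ≤ M * (X * M) := by
            refine mul_le_mul_of_nonneg_left (h1.trans_eq ?_) hM.le
            rw [hX]
            ring
        _ = M ^ 2 * X := by ring
        _ ≤ _ := h2.trans_eq (by ring)
    exact le_of_mul_le_mul_right h4 (by positivity)
  rw [← sq_ballScale ha, ← mul_pow]
  nlinarith

theorem differentiableOn_newtonMap (hf : DifferentiableOn ℂ f (ball ω R)) {θ : ℝ}
    (hθ : ball (ω + (R : ℂ) • a) θ ⊆ ball ω R) :
    DifferentiableOn ℂ (newtonMap ω R a f A) (ball 0 θ) := by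
  have h1 : Differentiable ℂ fun h => 1 - ballSlope R a h :=
    ((innerSL ℂ a).differentiable.const_mul _).const_sub 1
  have h2 : DifferentiableOn ℂ (fun h => f (ω + (R : ℂ) • a + h)) (ball 0 θ) :=
    hf.comp (differentiableOn_id.const_add _) fun h hh => hθ (by simpa using hh)
  exact differentiableOn_id.sub ((h1.pow (n + 2)).differentiableOn.smul
    (A.symm.differentiable.comp_differentiableOn h2))

theorem newtonMap_eq_self_iff {h : En n} (hq : 1 - ballSlope R a h ≠ 0) :
    newtonMap ω R a f A h = h ↔ f (ω + (R : ℂ) • a + h) = 0 := by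
  simp [newtonMap, hq]

end AlphaTheorem

/-- (α-theorem)  Let `f = (f₁,…,f_n) ∈ A²(ω,R)^n` and `x₀ ∈ B(ω,R)` with `Df(x₀)`
invertible.  With `ν = ‖x₀−ω‖/R`, `κ = max(1, (n+1)/(R(1−ν²)))`,
`λ = ‖f‖/(1−ν²)^{(n+1)/2}`, `μ = ‖Df(x₀)⁻¹‖`, `γ = max(1, λκμ)`,
`β = ‖Df(x₀)⁻¹ f(x₀)‖` and `α = βκ`, suppose `α < 2γ + 1 − √((2γ+1)² − 1)`.
Then for every `θ > 0` such that `B(x₀,θ) ⊆ B(ω,R)` and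
`(α + 1 − √((α+1)² − 4α(γ+1)))/(2(γ+1)) < κθ < 1/(γ+1)`, the system `f` has a unique zero
in the ball `B(x₀,θ)`. -/
theorem stmt10 (n : ℕ) (hn : 2 ≤ n) (ω : En n) (R : ℝ) (hR : 0 < R)
    (f : En n → En n) (hf : MemA2 ω R f)
    (x₀ : En n) (hx₀ : x₀ ∈ ball ω R)
    (A : En n ≃L[ℂ] En n) (hA : (A : En n →L[ℂ] En n) = fderiv ℂ f x₀) :
    let ν : ℝ := ‖x₀ - ω‖ / R
    let κ : ℝ := max 1 (((n : ℝ) + 1) / (R * (1 - ν ^ 2)))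
    let lam : ℝ := A2Norm ω R f / (1 - ν ^ 2) ^ (((n : ℝ) + 1) / 2)
    let μ : ℝ := ‖(A.symm : En n →L[ℂ] En n)‖
    let γ : ℝ := max 1 (lam * κ * μ)
    let α : ℝ := ‖A.symm (f x₀)‖ * κ
    α < 2 * γ + 1 - Real.sqrt ((2 * γ + 1) ^ 2 - 1) →
    ∀ θ : ℝ, 0 < θ → ball x₀ θ ⊆ ball ω R →
      (α + 1 - Real.sqrt ((α + 1) ^ 2 - 4 * α * (γ + 1))) / (2 * (γ + 1)) < κ * θ →
      κ * θ < 1 / (γ + 1) →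
      ∃! z : En n, z ∈ ball x₀ θ ∧ f z = 0 := by
  intro ν κ lam μ γ α hα θ hθ hsub hθ1 hθ2
  have hRc : (R : ℂ) ≠ 0 := by exact_mod_cast hR.ne'
  set a : En n := (R : ℂ)⁻¹ • (x₀ - ω) with ha_def
  have hx : ω + (R : ℂ) • a = x₀ := by rw [ha_def, smul_inv_smul₀ hRc, add_sub_cancel]
  have haν : ‖a‖ = ν := by
    rw [ha_def, norm_smul, norm_inv, Complex.norm_real, Real.norm_of_nonneg hR.le, inv_mul_eq_div]
  have ha : ‖a‖ < 1 := by
    rw [haν, div_lt_one hR]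
    exact mem_ball_iff_norm.1 hx₀
  have hs := ballScale_pos ha
  have hs2 : ballScale a ^ 2 = 1 - ν ^ 2 := by rw [sq_ballScale ha, haν]
  have hf1 : DifferentiableOn ℂ f (ball ω R) := hf.1.differentiableOn
  have hκ1 : 1 ≤ κ := le_max_left _ _
  have hκ : (n + 1) / (R * ballScale a ^ 2) ≤ κ := by
    rw [hs2]
    exact le_max_right _ _
  have hlam : lam = A2Norm 0 1 (ballPullback ω R a f) := by
    have hpow : (1 - ν ^ 2) ^ (((n : ℝ) + 1) / 2) = ballScale a ^ (n + 1) := by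
      rw [← hs2, ← Real.rpow_natCast, ← Real.rpow_natCast, ← Real.rpow_mul hs.le]
      congr 1
      push_cast
      ring
    simp only [lam]
    rw [hpow, A2Norm_ballPullback ha hR]
    field_simp
  have hγ : A2Norm 0 1 (ballPullback ω R a f) * κ * ‖(A.symm : En n →L[ℂ] En n)‖ ≤ γ := by
    rw [← hlam]
    exact le_max_right _ _
  have hγ1 : 1 ≤ γ := le_max_left _ _
  have hα0 : 0 ≤ α := by positivity
  rw [← hx] at hA
  have hγν := three_le_sq_mul hn ha hR hf1 hf.2 hA hκ hγ
  have hγ3 : 3 ≤ γ ^ 2 := (three_le_sq_of_le (by linarith) hγν).1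
  have hmaj := majorant_lt (norm_nonneg a) ha hγ1 hα0 hγν hα hθ1 hθ2
  set T := κ * θ with hT
  set ρ := (α + 4 / 3 * ‖a‖ * α * T + γ * T ^ 2 / 2) / κ with hρ_def
  have hlt : ∀ h ∈ ball (0 : En n) θ, κ * ‖h‖ < T := fun h hh =>
    mul_lt_mul_of_pos_left (mem_ball_zero_iff.1 hh) (by linarith)
  have hmaps : ∀ h ∈ ball (0 : En n) θ, ‖newtonMap ω R a f A h‖ ≤ ρ := by
    intro h hh
    have h1 := hlt h hh
    rw [hρ_def, le_div_iff₀' (by linarith)]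
    refine (norm_newtonMap_le hn ha hR hf1 hf.2 hA (by linarith) hκ (by linarith) hγ3 hγ
      (h1.trans hθ2)).trans ?_
    rw [hx]
    simp only [α]
    gcongr
  have hρ : ρ < θ := by
    rw [hρ_def, div_lt_iff₀' (by linarith)]
    exact hmaj
  have hslope : ∀ h ∈ ball (0 : En n) θ, 1 - ballSlope R a h ≠ 0 := by
    intro h hh
    refine one_sub_ballSlope_ne_zero ha hR hκ ?_
    refine ((hlt h hh).trans hθ2).trans_le ?_
    rw [div_le_one (by linarith)]
    linarith
  obtain ⟨h, ⟨hh, hfix⟩, huniq⟩ := existsUnique_fixedPoint_ball hθ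
    (differentiableOn_newtonMap (A := A) hf1 (by rwa [hx])) hρ hmaps
  rw [newtonMap_eq_self_iff (hslope h hh), hx] at hfix
  refine ⟨x₀ + h, ⟨by simpa using hh, hfix⟩, ?_⟩
  rintro z ⟨hz, hfz⟩
  have hz' : z - x₀ ∈ ball (0 : En n) θ := by
    rw [mem_ball_zero_iff]
    exact mem_ball_iff_norm.1 hz
  have := huniq (z - x₀) ⟨hz', by
    rw [newtonMap_eq_self_iff (hslope _ hz'), hx, add_sub_cancel, hfz]⟩
  rw [← this, add_sub_cancel]
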